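/- arXiv:1003.1928 — 12 statements merged into one kernel-verified Lean document; each statement's English description precedes it below -/
import Mathlib

section
/- Let d ≥ 1 and let u₀ : ℝ^d → ℝ be continuous and coercive (u₀(x)/‖x‖ → +∞ as ‖x‖ → ∞). Then for every x ∈ ℝ^d the infimum defining E(x) := inf { ∑_{i=1}^{d+1} λᵢ u₀(xᵢ) : λᵢ ≥ 0, ∑_{i=1}^{d+1} λᵢ = 1, ∑_{i=1}^{d+1} λᵢ xᵢ = x } is attained: there exist points x₁,…,x_{d+1} ∈ ℝ^d and coefficients λ₁,…,λ_{d+1} ≥ 0 with ∑λᵢ = 1, ∑λᵢxᵢ = x and ∑λᵢu₀(xᵢ) = E(x). -/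
open Filter

lemma coercive_lower {d : ℕ} (u₀ : EuclideanSpace ℝ (Fin d) → ℝ)
    (hcont : Continuous u₀)
    (hcoer : Tendsto (fun x => u₀ x / ‖x‖) (cocompact (EuclideanSpace ℝ (Fin d))) atTop)
    (A : ℝ) : ∃ C : ℝ, ∀ x, A * ‖x‖ - C ≤ u₀ x := by
  have h := hcoer.eventually_ge_atTop A
  obtain ⟨K, hK, hKs⟩ := mem_cocompact.1 h
  have hK0 : IsCompact (insert 0 K) := hK.insert 0
  have hc : Continuous (fun x => u₀ x - A * ‖x‖) := by fun_prop
  obtain ⟨m, hm⟩ := (hK0.image hc).bddBelow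
  refine ⟨max (-m) 0, fun x => ?_⟩
  by_cases hx : x ∈ insert 0 K
  · have := hm (Set.mem_image_of_mem _ hx)
    have h2 := le_max_left (-m) 0
    linarith
  · rw [Set.mem_insert_iff, not_or] at hx
    have h1 : A ≤ u₀ x / ‖x‖ := hKs hx.2
    have h2 : 0 < ‖x‖ := norm_pos_iff.2 hx.1
    rw [le_div_iff₀ h2] at h1
    have h2 := le_max_right (-m) 0
    linarith

/-- For a continuous coercive function `u₀` on `ℝ^d`, the infimum in the (d+1)-point
Carathéodory formula for the convex envelope is attained at every point. -/
theorem caratheodory_envelope_inf_attained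
    (d : ℕ) (hd : 1 ≤ d) (u₀ : EuclideanSpace ℝ (Fin d) → ℝ)
    (hcont : Continuous u₀)
    (hcoer : Tendsto (fun x => u₀ x / ‖x‖) (cocompact (EuclideanSpace ℝ (Fin d))) atTop)
    (E : EuclideanSpace ℝ (Fin d) → ℝ)
    (hE : ∀ x, E x = sInf { s : ℝ |
      ∃ (pts : Fin (d + 1) → EuclideanSpace ℝ (Fin d)) (lam : Fin (d + 1) → ℝ),
        (∀ i, 0 ≤ lam i) ∧ (∑ i, lam i = 1) ∧ (∑ i, lam i • pts i = x) ∧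
          s = ∑ i, lam i * u₀ (pts i) })
    (x : EuclideanSpace ℝ (Fin d)) :
    ∃ (pts : Fin (d + 1) → EuclideanSpace ℝ (Fin d)) (lam : Fin (d + 1) → ℝ),
      (∀ i, 0 ≤ lam i) ∧ (∑ i, lam i = 1) ∧ (∑ i, lam i • pts i = x) ∧
        ∑ i, lam i * u₀ (pts i) = E x := by
  classical
  obtain ⟨C, hC⟩ := coercive_lower u₀ hcont hcoer 0
  have hC' : ∀ y, 0 ≤ u₀ y + C := fun y => by have := hC y; linarith
  rw [hE x]
  set S := { s : ℝ |
      ∃ (pts : Fin (d + 1) → EuclideanSpace ℝ (Fin d)) (lam : Fin (d + 1) → ℝ),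
        (∀ i, 0 ≤ lam i) ∧ (∑ i, lam i = 1) ∧ (∑ i, lam i • pts i = x) ∧
          s = ∑ i, lam i * u₀ (pts i) } with hS
  have hsum : ∀ (pts : Fin (d + 1) → EuclideanSpace ℝ (Fin d)) (lam : Fin (d + 1) → ℝ),
      ∑ i, lam i = 1 → ∑ i, lam i * (u₀ (pts i) + C) = ∑ i, lam i * u₀ (pts i) + C := by
    intro pts lam h
    simp only [mul_add, Finset.sum_add_distrib]
    rw [← Finset.sum_mul, h, one_mul]
  have hbdd : BddBelow S := by
    refine ⟨-C, ?_⟩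
    rintro s ⟨pts, lam, h0, h1, -, rfl⟩
    have h2 := hsum pts lam h1
    have h3 : 0 ≤ ∑ i, lam i * (u₀ (pts i) + C) :=
      Finset.sum_nonneg fun i _ => mul_nonneg (h0 i) (hC' _)
    linarith
  have hne : S.Nonempty := by
    refine ⟨_, fun _ => x, Pi.single 0 1, ?_, ?_, ?_, rfl⟩
    · intro i
      by_cases hi : i = 0
      · subst hi; simp
      · simp [hi]
    · simp
    · rw [← Finset.sum_smul]; simp
  obtain ⟨s, hanti, hlim, hmem⟩ := exists_seq_tendsto_sInf hne hbdd
  choose p lam h0 h1 hx hs using hmem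
  set M := s 0 + C with hM
  have hterm : ∀ n i, lam n i * u₀ (p n i) ≤ M - C * lam n i := by
    intro n i
    have h2 := hsum (p n) (lam n) (h1 n)
    have h3 := Finset.single_le_sum (f := fun i => lam n i * (u₀ (p n i) + C))
      (fun i _ => mul_nonneg (h0 n i) (hC' _)) (Finset.mem_univ i)
    have h4 := hanti (Nat.zero_le n)
    have h5 := hs n
    linarith
  have hlam1 : ∀ n i, lam n i ≤ 1 := by
    intro n i
    rw [← h1 n]
    exact Finset.single_le_sum (f := lam n) (fun i _ => h0 n i) (Finset.mem_univ i)
  -- superlinear bound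
  have hsup : ∀ A : ℝ, ∃ B : ℝ, ∀ n i,
      A * ‖lam n i • p n i‖ ≤ M + B * lam n i := by
    intro A
    obtain ⟨D, hD⟩ := coercive_lower u₀ hcont hcoer A
    refine ⟨D - C, fun n i => ?_⟩
    rw [norm_smul, Real.norm_of_nonneg (h0 n i)]
    have := mul_le_mul_of_nonneg_left (hD (p n i)) (h0 n i)
    have := hterm n i
    linarith
  obtain ⟨B, hB⟩ := hsup 1
  let q : ℕ → (Fin (d + 1) → ℝ) × (Fin (d + 1) → EuclideanSpace ℝ (Fin d)) :=
    fun n => (lam n, fun i => lam n i • p n i)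
  have hM0 : 0 ≤ M := by
    have h2 := hsum (p 0) (lam 0) (h1 0)
    have h3 : 0 ≤ ∑ i, lam 0 i * (u₀ (p 0 i) + C) :=
      Finset.sum_nonneg fun i _ => mul_nonneg (h0 0 i) (hC' _)
    have := hs 0
    linarith
  have hq : ∀ n, q n ∈ Metric.closedBall (0 : (Fin (d + 1) → ℝ) ×
      (Fin (d + 1) → EuclideanSpace ℝ (Fin d))) (1 + M + |B|) := by
    intro n
    have hR : 0 ≤ 1 + M + |B| := by positivity
    rw [mem_closedBall_zero_iff, norm_prod_le_iff, pi_norm_le_iff_of_nonneg hR,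
      pi_norm_le_iff_of_nonneg hR]
    refine ⟨fun i => ?_, fun i => ?_⟩
    · change ‖lam n i‖ ≤ _
      rw [Real.norm_of_nonneg (h0 n i)]
      have := hlam1 n i
      have := abs_nonneg B
      linarith
    · change ‖lam n i • p n i‖ ≤ _
      have h2 := hB n i
      have h3 : B * lam n i ≤ |B| * 1 :=
        mul_le_mul (le_abs_self B) (hlam1 n i) (h0 n i) (abs_nonneg B)
      linarith
  obtain ⟨⟨l, z⟩, -, φ, hφ, hqlim⟩ := (isCompact_closedBall _ _).tendsto_subseq hq
  have hl : ∀ i, Tendsto (fun n => lam (φ n) i) atTop (nhds (l i)) := fun i =>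
    (tendsto_pi_nhds.1 ((continuous_fst.tendsto _).comp hqlim)) i
  have hz : ∀ i, Tendsto (fun n => lam (φ n) i • p (φ n) i) atTop (nhds (z i)) := fun i =>
    (tendsto_pi_nhds.1 ((continuous_snd.tendsto _).comp hqlim)) i
  have hl0 : ∀ i, 0 ≤ l i := fun i => ge_of_tendsto' (hl i) fun n => h0 _ i
  have hl1 : ∑ i, l i = 1 := by
    have h2 := tendsto_finsetSum Finset.univ fun i _ => hl i
    simp only [h1] at h2
    exact tendsto_nhds_unique h2 tendsto_const_nhds
  have hz1 : ∑ i, z i = x := by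
    have h2 := tendsto_finsetSum Finset.univ fun i _ => hz i
    simp only [hx] at h2
    exact tendsto_nhds_unique h2 tendsto_const_nhds
  have hzero : ∀ i, l i = 0 → z i = 0 := by
    intro i hi
    by_contra hne
    have hpos : 0 < ‖z i‖ := norm_pos_iff.2 hne
    obtain ⟨D, hD⟩ := hsup ((M + 1) / ‖z i‖)
    have h2 := le_of_tendsto_of_tendsto' ((hz i).norm.const_mul ((M + 1) / ‖z i‖))
      (((hl i).const_mul D).const_add M) fun n => hD (φ n) i
    rw [hi, div_mul_cancel₀ _ hpos.ne'] at h2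
    linarith
  have hlz : ∑ i, l i • ((l i)⁻¹ • z i) = x := by
    rw [← hz1]
    refine Finset.sum_congr rfl fun i _ => ?_
    by_cases hi : l i = 0
    · simp [hi, hzero i hi]
    · rw [smul_inv_smul₀ hi]
  refine ⟨fun i => (l i)⁻¹ • z i, l, hl0, hl1, hlz, le_antisymm ?_ ?_⟩
  · have hg : ∀ i, Tendsto (fun n => if l i = 0 then -C * lam (φ n) i else
        lam (φ n) i * u₀ (p (φ n) i)) atTop (nhds (l i * u₀ ((l i)⁻¹ • z i))) := by
      intro i
      by_cases hi : l i = 0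
      · simp only [hi, if_true, zero_mul]
        have := (hl i).const_mul (-C)
        rwa [hi, mul_zero] at this
      · simp only [hi, if_false]
        refine (hl i).mul ((hcont.tendsto _).comp ?_)
        refine (((hl i).inv₀ hi).smul (hz i)).congr' ?_
        filter_upwards [(hl i).eventually_ne hi] with n hn
        rw [inv_smul_smul₀ hn]
    refine le_of_tendsto_of_tendsto' (tendsto_finsetSum Finset.univ fun i _ => hg i)
      (hlim.comp hφ.tendsto_atTop) fun n => ?_
    change _ ≤ s (φ n)
    rw [hs]
    refine Finset.sum_le_sum fun i _ => ?_
    split_ifs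
    · have := mul_nonneg (h0 (φ n) i) (hC' (p (φ n) i))
      linarith
    · exact le_rfl
  · exact csInf_le hbdd ⟨_, l, hl0, hl1, hlz, rfl⟩
end

section
/- Let d ≥ 1 and let u₀ : ℝ^d → ℝ be continuous and coercive (u₀(x)/‖x‖ → +∞ as ‖x‖ → ∞). Then for every x ∈ ℝ^d, E(x) = inf { ∫_{ℝ^d} u₀(x + y) dμ(y) : μ a Borel probability measure on ℝ^d with finite first moment, barycenter ∫ y dμ(y) = 0, and y ↦ u₀(x+y) μ-integrable }, where E(x) := inf { ∑_{i=1}^{d+1} λᵢ u₀(xᵢ) : λᵢ ≥ 0, ∑_{i=1}^{d+1} λᵢ = 1, ∑_{i=1}^{d+1} λᵢ xᵢ = x }. Equivalently, the convex envelope satisfies u₀**(x) = inf { 𝔼[u₀(x + X)] : X an integrable ℝ^d-valued random variable with 𝔼[X] = 0 }. -/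
open Filter MeasureTheory


abbrev CarVec (d : ℕ) := EuclideanSpace ℝ (Fin d)

/-- One reduction step: drop one of `n+1 > d+1` points without increasing the value. -/
lemma car_step {d n : ℕ} (hn : d + 1 ≤ n) (u : CarVec d → ℝ)
    (p : Fin (n + 1) → CarVec d) (w : Fin (n + 1) → ℝ) (hw : ∀ i, 0 ≤ w i)
    (hs : ∑ i, w i = 1) :
    ∃ (q : Fin n → CarVec d) (v : Fin n → ℝ), (∀ i, 0 ≤ v i) ∧ ∑ i, v i = 1 ∧
      ∑ i, v i • q i = ∑ i, w i • p i ∧ ∑ i, v i * u (q i) ≤ ∑ i, w i * u (p i) := by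
  have hdep : ¬ LinearIndependent ℝ (fun i => ((p i, 1) : CarVec d × ℝ)) := by
    intro h
    have := h.fintype_card_le_finrank
    simp at this
    omega
  rw [Fintype.not_linearIndependent_iff] at hdep
  obtain ⟨g₀, hg₀, i₁, hi₁⟩ := hdep
  have hg1 : ∑ i, g₀ i • p i = 0 := by
    have := congrArg Prod.fst hg₀
    simpa [Prod.fst_sum] using this
  have hg2 : ∑ i, g₀ i = 0 := by
    have := congrArg Prod.snd hg₀
    simpa [Prod.snd_sum] using this
  obtain ⟨g, h1, h2, h3, j, hj⟩ : ∃ g : Fin (n + 1) → ℝ, ∑ i, g i • p i = 0 ∧ ∑ i, g i = 0 ∧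
      ∑ i, g i * u (p i) ≤ 0 ∧ ∃ i, g i ≠ 0 := by
    rcases le_total (∑ i, g₀ i * u (p i)) 0 with h | h
    · exact ⟨g₀, hg1, hg2, h, i₁, hi₁⟩
    · refine ⟨fun i => - g₀ i, ?_, ?_, ?_, i₁, by simpa using hi₁⟩
      · simp [hg1]
      · simp [hg2]
      · simpa using h
  have hneg : ∃ i, g i < 0 := by
    by_contra! hc
    exact hj ((Finset.sum_eq_zero_iff_of_nonneg (fun i _ => hc i)).1 h2 j (Finset.mem_univ _))
  obtain ⟨k, hk⟩ := hneg
  obtain ⟨m, hm, hmin⟩ := Finset.exists_min_image (Finset.univ.filter (fun i => g i < 0))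
    (fun i => w i / (- g i)) ⟨k, by simpa using hk⟩
  have hgm : g m < 0 := by simpa using hm
  set t := w m / (- g m) with ht
  have ht0 : 0 ≤ t := div_nonneg (hw m) (by linarith)
  have hvm : w m + t * g m = 0 := by
    rw [ht]
    have : g m ≠ 0 := hgm.ne
    field_simp
    ring
  have hv : ∀ i, 0 ≤ w i + t * g i := by
    intro i
    by_cases hi : g i < 0
    · have := hmin i (by simpa using hi)
      rw [le_div_iff₀ (by linarith)] at this
      linarith
    · have := mul_nonneg ht0 (not_lt.1 hi)
      linarith [hw i]
  have key1 : ∑ i, (w i + t * g i) = 1 := by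
    rw [Finset.sum_add_distrib, ← Finset.mul_sum, h2, hs]; simp
  have key2 : ∑ i, (w i + t * g i) • p i = ∑ i, w i • p i := by
    simp only [add_smul, Finset.sum_add_distrib, mul_smul, ← Finset.smul_sum, h1]
    simp
  have key3 : ∑ i, (w i + t * g i) * u (p i) ≤ ∑ i, w i * u (p i) := by
    simp only [add_mul, Finset.sum_add_distrib, mul_assoc, ← Finset.mul_sum]
    have := mul_nonneg_of_nonpos_of_nonpos (neg_nonpos.2 ht0) h3
    linarith
  rw [Fin.sum_univ_succAbove _ m, hvm] at key1 key2 key3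
  simp only [zero_add, zero_smul, zero_mul] at key1 key2 key3
  exact ⟨fun i => p (m.succAbove i), fun i => w (m.succAbove i) + t * g (m.succAbove i),
    fun i => hv _, key1, key2, key3⟩

lemma car_reduce {d : ℕ} (u : CarVec d → ℝ) (n : ℕ) (hn : d + 1 ≤ n) :
    ∀ (p : Fin n → CarVec d) (w : Fin n → ℝ) (_ : ∀ i, 0 ≤ w i) (_ : ∑ i, w i = 1),
    ∃ (q : Fin (d + 1) → CarVec d) (v : Fin (d + 1) → ℝ), (∀ i, 0 ≤ v i) ∧ ∑ i, v i = 1 ∧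
      ∑ i, v i • q i = ∑ i, w i • p i ∧ ∑ i, v i * u (q i) ≤ ∑ i, w i * u (p i) := by
  induction n, hn using Nat.le_induction with
  | base => exact fun p w hw hs => ⟨p, w, hw, hs, rfl, le_rfl⟩
  | succ n hn ih =>
    intro p w hw hs
    obtain ⟨q, v, a1, a2, a3, a4⟩ := car_step hn u p w hw hs
    obtain ⟨q', v', b1, b2, b3, b4⟩ := ih q v a1 a2
    exact ⟨q', v', b1, b2, b3.trans a3, b4.trans a4⟩

/-- The set of values of `(d+1)`-point convex combinations at `x`. -/
def carSet {d : ℕ} (u : CarVec d → ℝ) (x : CarVec d) : Set ℝ :=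
  { s : ℝ | ∃ (pts : Fin (d + 1) → CarVec d) (lam : Fin (d + 1) → ℝ),
        (∀ i, 0 ≤ lam i) ∧ (∑ i, lam i = 1) ∧ (∑ i, lam i • pts i = x) ∧
          s = ∑ i, lam i * u (pts i) }

lemma carSet_self {d : ℕ} (u : CarVec d → ℝ) (x : CarVec d) : u x ∈ carSet u x := by
  refine ⟨fun _ => x, fun i => if i = 0 then 1 else 0, ?_, ?_, ?_, ?_⟩
  · intro i; dsimp only; split_ifs <;> norm_num
  · simp
  · simp
  · simp

lemma carSet_lower {d : ℕ} {u : CarVec d → ℝ} {C : ℝ} (hC : ∀ y, C ≤ u y) (x : CarVec d) :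
    ∀ s ∈ carSet u x, C ≤ s := by
  rintro s ⟨p, w, h1, h2, -, rfl⟩
  calc C = ∑ i, w i * C := by rw [← Finset.sum_mul, h2, one_mul]
    _ ≤ _ := Finset.sum_le_sum fun i _ => mul_le_mul_of_nonneg_left (hC _) (h1 i)

lemma carSet_convex {d : ℕ} {u : CarVec d → ℝ} {C : ℝ} (hC : ∀ y, C ≤ u y) :
    ConvexOn ℝ Set.univ (fun x => sInf (carSet u x)) := by
  refine ⟨convex_univ, ?_⟩
  intro x _ y _ a b ha hb hab
  dsimp only
  refine le_of_forall_pos_le_add fun ε hε => ?_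
  obtain ⟨s, ⟨p, w, h1, h2, h3, rfl⟩, hs⟩ := exists_lt_of_csInf_lt ⟨_, carSet_self u x⟩
    (lt_add_of_pos_right (sInf (carSet u x)) hε)
  obtain ⟨s', ⟨p', w', h1', h2', h3', rfl⟩, hs'⟩ := exists_lt_of_csInf_lt ⟨_, carSet_self u y⟩
    (lt_add_of_pos_right (sInf (carSet u y)) hε)
  obtain ⟨q, v, a1, a2, a3, a4⟩ := car_reduce u (d + 1 + (d + 1)) (by omega) (Fin.append p p')
    (Fin.append (fun i => a * w i) (fun i => b * w' i))
    (by
      intro i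
      refine Fin.addCases (fun i => ?_) (fun i => ?_) i
      · rw [Fin.append_left]; exact mul_nonneg ha (h1 i)
      · rw [Fin.append_right]; exact mul_nonneg hb (h1' i))
    (by
      rw [Fin.sum_univ_add]
      simp only [Fin.append_left, Fin.append_right, ← Finset.mul_sum, h2, h2', mul_one, hab])
  rw [Fin.sum_univ_add (a := d + 1) (b := d + 1)] at a3
  simp only [Fin.append_left, Fin.append_right, mul_smul, ← Finset.smul_sum, h3, h3'] at a3
  rw [Fin.sum_univ_add (a := d + 1) (b := d + 1)] at a4
  simp only [Fin.append_left, Fin.append_right, mul_assoc, ← Finset.mul_sum] at a4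
  have hle : sInf (carSet u (a • x + b • y)) ≤ ∑ i, v i * u (q i) :=
    csInf_le ⟨C, fun s hs => carSet_lower hC _ s hs⟩ ⟨q, v, a1, a2, a3, rfl⟩
  have e1 := mul_le_mul_of_nonneg_left hs.le ha
  have e2 := mul_le_mul_of_nonneg_left hs'.le hb
  simp only [smul_eq_mul]
  have : a * ε + b * ε = ε := by rw [← add_mul, hab, one_mul]
  linarith

lemma car_bdd {d : ℕ} {u : CarVec d → ℝ} (hcont : Continuous u)
    (hcoer : Tendsto (fun x => u x / ‖x‖) (cocompact (CarVec d)) atTop) :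
    ∃ C, ∀ y, C ≤ u y := by
  obtain ⟨K, hK, hKs⟩ := mem_cocompact.1 (hcoer.eventually_ge_atTop 0)
  obtain ⟨C, hC⟩ := (hK.image hcont).bddBelow
  refine ⟨min C (min (u 0) 0), fun y => ?_⟩
  by_cases hy : y ∈ K
  · exact (min_le_left _ _).trans (hC ⟨y, hy, rfl⟩)
  · refine (min_le_right _ _).trans ?_
    by_cases h0 : y = 0
    · rw [h0]; exact min_le_left _ _
    · have h := hKs hy
      simp only [Set.mem_ofPred_eq] at h
      have hp : 0 < ‖y‖ := norm_pos_iff.2 h0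
      rw [le_div_iff₀ hp, zero_mul] at h
      exact (min_le_right _ _).trans h

lemma car_le_integral {d : ℕ} {u : CarVec d → ℝ} (hcont : Continuous u) {C : ℝ}
    (hC : ∀ y, C ≤ u y) (x : CarVec d) (μ : Measure (CarVec d)) [IsProbabilityMeasure μ]
    (hi : Integrable (fun y => y) μ) (h0 : ∫ y, y ∂μ = 0)
    (hu : Integrable (fun y => u (x + y)) μ) :
    sInf (carSet u x) ≤ ∫ y, u (x + y) ∂μ := by
  have hconv := carSet_convex hC
  have hc : Continuous (fun x => sInf (carSet u x)) := hconv.locallyLipschitz.continuous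
  have hle : ∀ y, sInf (carSet u y) ≤ u y := fun y =>
    csInf_le ⟨C, fun s hs => carSet_lower hC _ s hs⟩ (carSet_self u y)
  have hge : ∀ y, C ≤ sInf (carSet u y) := fun y =>
    le_csInf ⟨_, carSet_self u y⟩ (carSet_lower hC y)
  have hfi : Integrable (fun y => x + y) μ := (integrable_const x).add hi
  have hgi : Integrable ((fun x => sInf (carSet u x)) ∘ (fun y => x + y)) μ := by
    refine Integrable.mono' (hu.norm.add (integrable_const |C|))
      (hc.comp (continuous_const.add continuous_id)).aestronglyMeasurable
      (Eventually.of_forall fun y => ?_)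
    simp only [Function.comp, Pi.add_apply, Real.norm_eq_abs]
    rw [abs_le]
    have := hle (x + y)
    have := hge (x + y)
    have := le_abs_self (u (x + y))
    have := neg_abs_le C
    have := abs_nonneg C
    have := abs_nonneg (u (x + y))
    constructor <;> linarith
  have hJ := hconv.map_integral_le hc.continuousOn isClosed_univ
    (Eventually.of_forall fun y => Set.mem_univ _) hfi hgi
  have hx : ∫ y, (x + y) ∂μ = x := by
    rw [integral_add (integrable_const x) hi, h0]; simp
  rw [hx] at hJ
  exact hJ.trans (integral_mono hgi hu fun y => hle _)

lemma car_integrable_sum {d n : ℕ} {F : Type*} [NormedAddCommGroup F]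
    (p : Fin n → CarVec d) (w : Fin n → ℝ) {f : CarVec d → F} :
    Integrable f (∑ i, ENNReal.ofReal (w i) • Measure.dirac (p i)) := by
  rw [integrable_finsetSum_measure]
  intro i _
  exact (integrable_dirac (by simp)).smul_measure ENNReal.ofReal_ne_top

lemma car_integral_sum {d n : ℕ} {F : Type*} [NormedAddCommGroup F] [NormedSpace ℝ F]
    [CompleteSpace F]
    (p : Fin n → CarVec d) (w : Fin n → ℝ) (hw : ∀ i, 0 ≤ w i) {f : CarVec d → F} :
    ∫ y, f y ∂(∑ i, ENNReal.ofReal (w i) • Measure.dirac (p i)) = ∑ i, w i • f (p i) := by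
  rw [integral_finsetSum_measure]
  · refine Finset.sum_congr rfl fun i _ => ?_
    rw [integral_smul_measure, integral_dirac, ENNReal.toReal_ofReal (hw i)]
  · intro i _
    exact (integrable_dirac (by simp)).smul_measure ENNReal.ofReal_ne_top

/-- For a continuous coercive `u₀` on `ℝ^d`, the (d+1)-point Carathéodory envelope
coincides with the infimum of `∫ u₀(x + y) dμ(y)` over centered probability measures `μ`
with finite first moment (the probabilistic formula for the convex envelope). -/
theorem caratheodory_envelope_eq_probabilistic_inf
    (d : ℕ) (hd : 1 ≤ d) (u₀ : EuclideanSpace ℝ (Fin d) → ℝ)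
    (hcont : Continuous u₀)
    (hcoer : Tendsto (fun x => u₀ x / ‖x‖) (cocompact (EuclideanSpace ℝ (Fin d))) atTop)
    (E : EuclideanSpace ℝ (Fin d) → ℝ)
    (hE : ∀ x, E x = sInf { s : ℝ |
      ∃ (pts : Fin (d + 1) → EuclideanSpace ℝ (Fin d)) (lam : Fin (d + 1) → ℝ),
        (∀ i, 0 ≤ lam i) ∧ (∑ i, lam i = 1) ∧ (∑ i, lam i • pts i = x) ∧
          s = ∑ i, lam i * u₀ (pts i) })
    (x : EuclideanSpace ℝ (Fin d)) :
    E x = sInf { s : ℝ | ∃ μ : Measure (EuclideanSpace ℝ (Fin d)),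
      IsProbabilityMeasure μ ∧
      Integrable (fun y => y) μ ∧
      (∫ y, y ∂μ) = 0 ∧
      Integrable (fun y => u₀ (x + y)) μ ∧
      s = ∫ y, u₀ (x + y) ∂μ } := by
  obtain ⟨C, hC⟩ := car_bdd hcont hcoer
  rw [hE x]
  change sInf (carSet u₀ x) = _
  have hsub : carSet u₀ x ⊆ { s : ℝ | ∃ μ : Measure (EuclideanSpace ℝ (Fin d)),
      IsProbabilityMeasure μ ∧
      Integrable (fun y => y) μ ∧
      (∫ y, y ∂μ) = 0 ∧
      Integrable (fun y => u₀ (x + y)) μ ∧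
      s = ∫ y, u₀ (x + y) ∂μ } := by
    rintro s ⟨p, w, h1, h2, h3, rfl⟩
    refine ⟨∑ i, ENNReal.ofReal (w i) • Measure.dirac (p i - x), ⟨?_⟩, car_integrable_sum _ _, ?_,
      car_integrable_sum _ _, ?_⟩
    · simp only [Measure.coe_finsetSum, Finset.sum_apply, Measure.smul_apply, measure_univ,
        smul_eq_mul, mul_one]
      rw [← ENNReal.ofReal_sum_of_nonneg (fun i _ => h1 i), h2, ENNReal.ofReal_one]
    · rw [car_integral_sum _ _ h1]
      simp only [smul_sub, Finset.sum_sub_distrib, ← Finset.sum_smul, h2, h3]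
      simp
    · rw [car_integral_sum _ _ h1]
      simp
  apply le_antisymm
  · refine le_csInf ⟨_, hsub (carSet_self u₀ x)⟩ ?_
    rintro s ⟨μ, hμ, hi, h0, hu, rfl⟩
    exact car_le_integral hcont hC x μ hi h0 hu
  · refine csInf_le_csInf ⟨sInf (carSet u₀ x), ?_⟩ ⟨_, carSet_self u₀ x⟩ hsub
    rintro s ⟨μ, hμ, hi, h0, hu, rfl⟩
    exact car_le_integral hcont hC x μ hi h0 hu
end

section
/- Let M ≥ 0 and let u₀ : ℝ^d → ℝ be such that x ↦ u₀(x) − (M/2)‖x‖² is concave. Let A be a nonempty index set and for each α ∈ A let μ_α be a Borel probability measure on ℝ^d with finite second moment, barycenter ∫ y dμ_α(y) = 0, and such that for every x ∈ ℝ^d the function y ↦ u₀(x+y) is μ_α-integrable. Define φ(x) := inf_{α ∈ A} ∫_{ℝ^d} u₀(x + y) dμ_α(y) and assume φ(x) > −∞ for all x. Then x ↦ φ(x) − (M/2)‖x‖² is concave on ℝ^d. -/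
open MeasureTheory

/-- If `u₀ − (M/2)‖·‖²` is concave and `φ` is the pointwise infimum over a nonempty family
of expectations `x ↦ ∫ u₀(x + y) dμ_α(y)` against centered probability measures with finite
second moment, and `φ > −∞` everywhere (the family of values is bounded below at each point),
then `φ − (M/2)‖·‖²` is concave. -/
theorem semiconcavity_of_inf_of_expectations
    (d : ℕ) (M : ℝ) (hM : 0 ≤ M) (u₀ : EuclideanSpace ℝ (Fin d) → ℝ)
    (hconc : ConcaveOn ℝ Set.univ (fun x => u₀ x - M / 2 * ‖x‖ ^ 2))
    {A : Type*} [Nonempty A]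
    (μ : A → Measure (EuclideanSpace ℝ (Fin d)))
    (hprob : ∀ α, IsProbabilityMeasure (μ α))
    (hmom2 : ∀ α, Integrable (fun y => ‖y‖ ^ 2) (μ α))
    (hbary : ∀ α, (∫ y, y ∂(μ α)) = 0)
    (hint : ∀ α (x : EuclideanSpace ℝ (Fin d)), Integrable (fun y => u₀ (x + y)) (μ α))
    (hbdd : ∀ x : EuclideanSpace ℝ (Fin d),
      BddBelow (Set.range fun α => ∫ y, u₀ (x + y) ∂(μ α)))
    (φ : EuclideanSpace ℝ (Fin d) → ℝ)
    (hφ : ∀ x, φ x = ⨅ α, ∫ y, u₀ (x + y) ∂(μ α)) :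
    ConcaveOn ℝ Set.univ (fun x => φ x - M / 2 * ‖x‖ ^ 2) := by
  refine ⟨convex_univ, ?_⟩
  intro x _ z _ a b ha hb hab
  simp only [smul_eq_mul]
  set D : ℝ := M / 2 * (a * ‖x‖ ^ 2 + b * ‖z‖ ^ 2 - ‖a • x + b • z‖ ^ 2) with hD
  -- the quadratic defect is translation invariant
  have key : ∀ y, a * u₀ (x + y) + b * u₀ (z + y) - D ≤ u₀ (a • x + b • z + y) := by
    intro y
    have h := hconc.2 (Set.mem_univ (x + y)) (Set.mem_univ (z + y)) ha hb hab
    have e : a • (x + y) + b • (z + y) = a • x + b • z + y := by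
      have : y = (a + b) • y := by rw [hab, one_smul]
      conv_rhs => rw [this]
      module
    simp only [smul_eq_mul] at h
    rw [e] at h
    have e2 : a * ‖x + y‖ ^ 2 + b * ‖z + y‖ ^ 2 - ‖a • x + b • z + y‖ ^ 2
        = a * ‖x‖ ^ 2 + b * ‖z‖ ^ 2 - ‖a • x + b • z‖ ^ 2 := by
      rw [norm_add_sq_real x y, norm_add_sq_real z y, norm_add_sq_real (a • x + b • z) y,
        inner_add_left, real_inner_smul_left, real_inner_smul_left]
      linear_combination ‖y‖ ^ 2 * hab
    rw [← e2] at hD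
    rw [hD]
    linarith
  have main : a * φ x + b * φ z - D ≤ φ (a • x + b • z) := by
    rw [hφ (a • x + b • z)]
    refine le_ciInf fun α => ?_
    have := hprob α
    have hx : φ x ≤ ∫ y, u₀ (x + y) ∂(μ α) := by
      rw [hφ x]; exact ciInf_le (hbdd x) α
    have hz : φ z ≤ ∫ y, u₀ (z + y) ∂(μ α) := by
      rw [hφ z]; exact ciInf_le (hbdd z) α
    have i1 := (hint α x).const_mul a
    have i2 := (hint α z).const_mul b
    have h := integral_mono ((i1.add i2).sub (integrable_const D))
      (hint α (a • x + b • z)) key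
    have e : ∫ y, (a * u₀ (x + y) + b * u₀ (z + y) - D) ∂(μ α)
        = a * ∫ y, u₀ (x + y) ∂(μ α) + b * ∫ y, u₀ (z + y) ∂(μ α) - D := by
      have i3 : Integrable (fun y => a * u₀ (x + y) + b * u₀ (z + y)) (μ α) := i1.add i2
      rw [integral_sub i3 (integrable_const D), integral_add i1 i2,
        integral_const_mul, integral_const_mul]
      simp
    have h' : ∫ y, (a * u₀ (x + y) + b * u₀ (z + y) - D) ∂(μ α)
      ≤ ∫ y, u₀ (a • x + b • z + y) ∂(μ α) := h
    rw [e] at h'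
    have := mul_le_mul_of_nonneg_left hx ha
    have := mul_le_mul_of_nonneg_left hz hb
    linarith
  rw [hD] at main
  linarith
end

section
/- Let v : (0,∞) × ℝ^d → ℝ be continuous and suppose that v is a viscosity supersolution of λ₁(D²v) ≥ 0 in the following sense: for every function φ : (0,∞) × ℝ^d → ℝ of class C² and every point (t₀, x₀) ∈ (0,∞) × ℝ^d at which v − φ attains a local maximum, the spatial Hessian D²_x φ(t₀, x₀) (the d×d matrix of second derivatives of φ in the x variables) is positive semidefinite. Then for every t > 0 the function x ↦ v(t, x) is convex on ℝ^d. -/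
/-- If a continuous function `v` on `(0,∞) × ℝ^d` is a viscosity supersolution of
`λ₁(D²v) ≥ 0` — i.e. whenever a `C²` test function `φ` touches `v` from below
(that is, `v − φ` has a local maximum on the domain) at a point `(t₀, x₀)` of the domain,
the spatial Hessian of `φ` at that point is positive semidefinite — then `v(t, ·)` is
convex for every `t > 0`.  Positive semidefiniteness of the spatial Hessian is expressed
through the second derivative of `s ↦ φ(t₀, x₀ + s h)` at `s = 0` being nonnegative for
every direction `h`. -/
theorem convexity_of_viscosity_supersolution
    (d : ℕ) (v : ℝ × EuclideanSpace ℝ (Fin d) → ℝ)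
    (hv : ContinuousOn v (Set.Ioi (0 : ℝ) ×ˢ (Set.univ : Set (EuclideanSpace ℝ (Fin d)))))
    (hsuper : ∀ φ : ℝ × EuclideanSpace ℝ (Fin d) → ℝ, ContDiff ℝ 2 φ →
      ∀ t₀ : ℝ, 0 < t₀ → ∀ x₀ : EuclideanSpace ℝ (Fin d),
        IsLocalMaxOn (fun p => v p - φ p)
          (Set.Ioi (0 : ℝ) ×ˢ (Set.univ : Set (EuclideanSpace ℝ (Fin d)))) (t₀, x₀) →
        ∀ h : EuclideanSpace ℝ (Fin d),
          0 ≤ iteratedDeriv 2 (fun s : ℝ => φ (t₀, x₀ + s • h)) 0) :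
    ∀ t : ℝ, 0 < t → ConvexOn ℝ Set.univ (fun x => v (t, x)) := by
  intro T hT
  refine ⟨convex_univ, ?_⟩
  intro x _ y _ a b ha hb hab
  by_contra hcon
  simp only [smul_eq_mul, not_le] at hcon
  have hxy : y - x ≠ 0 := by
    intro h
    have : y = x := sub_eq_zero.mp h
    subst this
    rw [← add_smul, hab, one_smul, ← add_mul, hab, one_mul] at hcon
    exact lt_irrefl _ hcon
  obtain ⟨e, he⟩ : ∃ e, e = y - x := ⟨_, rfl⟩
  rw [← he] at hxy
  have hee : inner ℝ e e ≠ 0 := by simpa using hxy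
  obtain ⟨c, hc⟩ : ∃ c : ℝ, c * inner ℝ e e = 1 := ⟨(inner ℝ e e)⁻¹, inv_mul_cancel₀ hee⟩
  obtain ⟨S, hS⟩ : ∃ S : EuclideanSpace ℝ (Fin d) → ℝ, S = fun p => c * inner ℝ e (p - x) :=
    ⟨_, rfl⟩
  obtain ⟨W, hW⟩ : ∃ W : EuclideanSpace ℝ (Fin d) → EuclideanSpace ℝ (Fin d),
      W = fun p => p - x - S p • e := ⟨_, rfl⟩
  have hSd : ContDiff ℝ 2 S := by 
    rw [hS]
    exact contDiff_const.mul (contDiff_const.inner ℝ (contDiff_id.sub contDiff_const))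
  have hWd : ContDiff ℝ 2 W := by rw [hW]; fun_prop
  have hSe : ∀ p σ, S (p + σ • e) = S p + σ := by
    intro p σ
    have : p + σ • e - x = (p - x) + σ • e := by abel
    simp only [hS, this, inner_add_right, inner_smul_right]
    linear_combination σ * hc
  have hWe : ∀ p (σ : ℝ), W (p + σ • e) = W p := by
    intro p σ
    simp only [hW, hSe, add_smul]
    abel
  have hSx : S x = 0 := by simp [hS]
  have hWx : W x = 0 := by simp [hW, hSx]
  have hz : a • x + b • y = x + b • e := by
    rw [he, smul_sub]
    have : a = 1 - b := by linarith
    rw [this, sub_smul, one_smul]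
    abel
  rw [hz] at hcon
  obtain ⟨A, hA⟩ : ∃ A, A = v (T, x) := ⟨_, rfl⟩
  obtain ⟨B, hB⟩ : ∃ B, B = v (T, y) := ⟨_, rfl⟩
  obtain ⟨m, hm⟩ : ∃ m, m = v (T, x + b • e) - (a * A + b * B) := ⟨_, rfl⟩
  have hmpos : 0 < m := by rw [hm, hA, hB]; linarith
  have hcont : ∀ p, ContinuousAt v (T, p) := fun p =>
    hv.continuousAt ((isOpen_Ioi.prod isOpen_univ).mem_nhds ⟨hT, trivial⟩)
  obtain ⟨r₁, hr₁, h₁⟩ := Metric.continuousAt_iff.mp (hcont x) (m / 2) (by linarith)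
  obtain ⟨r₂, hr₂, h₂⟩ := Metric.continuousAt_iff.mp (hcont y) (m / 2) (by linarith)
  obtain ⟨r, hr, hrT, hrr₁, hrr₂⟩ : ∃ r, 0 < r ∧ r < T ∧ r < r₁ ∧ r < r₂ := by
    refine ⟨min T (min r₁ r₂) / 2, by positivity, ?_, ?_, ?_⟩
    all_goals
      have h0 : 0 < min T (min r₁ r₂) := by positivity
      have h1 := min_le_left T (min r₁ r₂)
      have h2 := min_le_right T (min r₁ r₂)
      have h3 := min_le_left r₁ r₂
      have h4 := min_le_right r₁ r₂
      linarith
  obtain ⟨q, hq⟩ : ∃ q : ℝ × EuclideanSpace ℝ (Fin d) → ℝ,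
      q = fun P => ‖W P.2‖ ^ 2 + (P.1 - T) ^ 2 := ⟨_, rfl⟩
  have hqd : ContDiff ℝ 2 q := by
    rw [hq]
    exact ((hWd.comp contDiff_snd).norm_sq ℝ).add ((contDiff_fst.sub contDiff_const).pow 2)
  have hS2 : ContDiff ℝ 2 (fun P : ℝ × EuclideanSpace ℝ (Fin d) => S P.2) :=
    hSd.comp contDiff_snd
  obtain ⟨K, hK⟩ : ∃ K : Set (ℝ × EuclideanSpace ℝ (Fin d)),
      K = {P | 0 ≤ S P.2 ∧ S P.2 ≤ 1 ∧ q P ≤ r ^ 2} := ⟨_, rfl⟩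
  have hqb : ∀ P, q P ≤ r ^ 2 → ‖W P.2‖ ≤ r ∧ |P.1 - T| ≤ r := by
    intro P hP
    simp only [hq] at hP
    exact ⟨abs_le_of_sq_le_sq' (by nlinarith [sq_nonneg (P.1 - T)]) hr.le |>.2,
      abs_le_of_sq_le_sq (by nlinarith [sq_nonneg ‖W P.2‖]) hr.le⟩
  have hdec : ∀ p, p = x + S p • e + W p := by
    intro p; simp only [hW]; abel
  have hKclosed : IsClosed K := by
    rw [hK]
    exact (isClosed_le continuous_const hS2.continuous).inter
      ((isClosed_le hS2.continuous continuous_const).inter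
        (isClosed_le hqd.continuous continuous_const))
  have hKcompact : IsCompact K := by
    refine ((isCompact_closedBall T r).prod
      (isCompact_closedBall x (‖e‖ + r))).of_isClosed_subset hKclosed ?_
    rintro ⟨t, p⟩ hP
    rw [hK] at hP
    obtain ⟨h0, h1, h2⟩ := hP
    obtain ⟨h3, h4⟩ := hqb _ h2
    simp only at h0 h1 h3 h4
    refine ⟨by simpa [Real.dist_eq] using h4, ?_⟩
    rw [mem_closedBall_iff_norm]
    have : p - x = S p • e + W p := by simp only [hW]; abel
    simp only [this]
    refine (norm_add_le _ _).trans ?_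
    rw [norm_smul, Real.norm_eq_abs, abs_of_nonneg h0]
    nlinarith [norm_nonneg e]
  have hKdom : K ⊆ Set.Ioi (0 : ℝ) ×ˢ (Set.univ : Set (EuclideanSpace ℝ (Fin d))) := by
    rintro P hP
    rw [hK] at hP
    have := (abs_le.mp (hqb _ hP.2.2).2).1
    refine ⟨?_, trivial⟩
    simp only [Set.mem_Ioi]
    linarith
  have hvK := hv.mono hKdom
  obtain ⟨L, hL⟩ : ∃ L : ℝ × EuclideanSpace ℝ (Fin d) → ℝ,
      L = fun P => A + (B - A) * S P.2 + m / 2 * (S P.2 * (1 - S P.2)) := ⟨_, rfl⟩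
  have hLd : ContDiff ℝ 2 L := by rw [hL]; fun_prop
  obtain ⟨C, hC⟩ := (hKcompact.image_of_continuousOn
    (hvK.sub hLd.continuous.continuousOn)).bddAbove
  have hC' : ∀ P ∈ K, v P - L P ≤ C := fun P hP => hC ⟨P, hP, rfl⟩
  obtain ⟨M, hM⟩ : ∃ M, M = |C| / r ^ 2 := ⟨_, rfl⟩
  have hM0 : 0 ≤ M := by rw [hM]; positivity
  have hMr : M * r ^ 2 = |C| := by rw [hM]; field_simp
  obtain ⟨φ, hφ⟩ : ∃ φ : ℝ × EuclideanSpace ℝ (Fin d) → ℝ,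
      φ = fun P => L P + M * q P := ⟨_, rfl⟩
  have hφd : ContDiff ℝ 2 φ := by rw [hφ]; exact hLd.add (contDiff_const.mul hqd)
  have hSz : S (x + b • e) = b := by rw [hSe, hSx, zero_add]
  have hWz : W (x + b • e) = 0 := by rw [hWe, hWx]
  have hqz : q (T, x + b • e) = 0 := by simp [hq, hWz]
  have hzK : (T, x + b • e) ∈ K := by
    rw [hK]
    refine ⟨by simpa only [hSz] using hb, by simp only [hSz]; linarith, ?_⟩
    rw [hqz]; positivity
  obtain ⟨P, hPK, hPmax⟩ := hKcompact.exists_isMaxOn ⟨_, hzK⟩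
    (hvK.sub hφd.continuous.continuousOn)
  have hPz : v (T, x + b • e) - φ (T, x + b • e) ≤ v P - φ P := hPmax hzK
  have hzval : m / 2 < v (T, x + b • e) - φ (T, x + b • e) := by
    simp only [hφ, hqz, hL, hSz]
    have : a = 1 - b := by linarith
    rw [this] at hm
    nlinarith [sq_nonneg (b - 1 / 2)]
  have hPval := hzval.trans_le hPz
  have hq0 : ∀ P, 0 ≤ q P := fun P => by simp only [hq]; positivity
  have hPK' := hPK
  rw [hK] at hPK'
  obtain ⟨hP0, hP1, hPq⟩ := hPK'
  obtain ⟨hPW, hPT⟩ := hqb _ hPq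
  have hMq := mul_nonneg hM0 (hq0 P)
  have hlt0 : 0 < S P.2 := by
    refine lt_of_le_of_ne hP0 fun h => ?_
    have hd : dist P (T, x) < r₁ := by
      rw [Prod.dist_eq, max_lt_iff, Real.dist_eq, dist_eq_norm]
      refine ⟨hPT.trans_lt hrr₁, ?_⟩
      have : P.2 - x = W P.2 := by simp [hW, ← h]
      simp only [this]
      exact hPW.trans_lt hrr₁
    have h3 := (abs_lt.mp (h₁ hd)).2
    simp only [hφ, hL, ← h] at hPval
    linarith
  have hlt1 : S P.2 < 1 := by
    refine lt_of_le_of_ne hP1 fun h => ?_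
    have hd : dist P (T, y) < r₂ := by
      rw [Prod.dist_eq, max_lt_iff, Real.dist_eq, dist_eq_norm]
      refine ⟨hPT.trans_lt hrr₂, ?_⟩
      have : P.2 - y = W P.2 := by simp [hW, h, he]
      simp only [this]
      exact hPW.trans_lt hrr₂
    have h3 := (abs_lt.mp (h₂ hd)).2
    simp only [hφ, hL, h] at hPval
    linarith
  have hltq : q P < r ^ 2 := by
    refine lt_of_le_of_ne hPq fun h => ?_
    have := hC' P hPK
    simp only [hφ, h, hMr] at hPval
    linarith [le_abs_self C]
  have hnhds : K ∈ nhds P := by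
    have hU : IsOpen {P : ℝ × EuclideanSpace ℝ (Fin d) | 0 < S P.2 ∧ S P.2 < 1 ∧ q P < r ^ 2} :=
      (isOpen_lt continuous_const hS2.continuous).inter
      ((isOpen_lt hS2.continuous continuous_const).inter
        (isOpen_lt hqd.continuous continuous_const))
    refine Filter.mem_of_superset (hU.mem_nhds ⟨hlt0, hlt1, hltq⟩) ?_
    rintro Q ⟨h1, h2, h3⟩
    rw [hK]
    exact ⟨h1.le, h2.le, h3.le⟩
  have hloc : IsLocalMaxOn (fun p => v p - φ p)
      (Set.Ioi (0 : ℝ) ×ˢ (Set.univ : Set (EuclideanSpace ℝ (Fin d)))) (P.1, P.2) :=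
    (hPmax.isLocalMax hnhds).on _
  have hfin := hsuper φ hφd P.1 (hKdom hPK).1 P.2 hloc e
  have hfun : (fun s : ℝ => φ (P.1, P.2 + s • e)) = fun s =>
      A + (B - A) * (S P.2 + s) + m / 2 * ((S P.2 + s) * (1 - (S P.2 + s))) + M * q P := by
    funext s
    simp only [hφ, hL, hq, hSe, hWe]
  have hd1 : deriv (fun s : ℝ =>
      A + (B - A) * (S P.2 + s) + m / 2 * ((S P.2 + s) * (1 - (S P.2 + s))) + M * q P) =
      fun s => (B - A) + m / 2 * (1 - 2 * (S P.2 + s)) := by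
    funext s
    have h1 : HasDerivAt (fun s : ℝ => S P.2 + s) 1 s := (hasDerivAt_id s).const_add _
    have h2 := (((h1.const_mul (B - A)).const_add A).add
      ((h1.mul (h1.const_sub 1)).const_mul (m / 2))).add_const (M * q P)
    refine (HasDerivAt.deriv h2).trans ?_
    ring
  have hd2 : deriv (fun s : ℝ => (B - A) + m / 2 * (1 - 2 * (S P.2 + s))) 0 = -m := by
    have h1 : HasDerivAt (fun s : ℝ => S P.2 + s) 1 0 := (hasDerivAt_id 0).const_add _
    have h2 := (((h1.const_mul 2).const_sub 1).const_mul (m / 2)).const_add (B - A)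
    refine (HasDerivAt.deriv h2).trans ?_
    ring
  rw [hfun, iteratedDeriv_succ, iteratedDeriv_one, hd1, hd2] at hfin
  linarith
end

section
/- Let M ≥ 0, r > 0, and let v : ℝ^d → ℝ be continuous with x ↦ v(x) + (M/2)‖x‖² convex. Then for every x in the open ball B_r of radius r centered at the origin at which v is differentiable, one has ‖∇v(x)‖ ≤ (2/r) · sup_{B_{2r}} |v| + Mr/2. -/
/-- First gradient estimate for `M`-semiconvex functions: if `v` is continuous with
`v + (M/2)‖·‖²` convex, then at every point `x` of the ball `B_r` where `v` is
differentiable, `‖∇v(x)‖ ≤ (2/r) · sup_{B_{2r}} |v| + Mr/2`. -/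
theorem semiconvex_gradient_bound_ball
    (d : ℕ) (M r : ℝ) (hM : 0 ≤ M) (hr : 0 < r)
    (v : EuclideanSpace ℝ (Fin d) → ℝ) (hcont : Continuous v)
    (hconv : ConvexOn ℝ Set.univ (fun x => v x + M / 2 * ‖x‖ ^ 2))
    (x : EuclideanSpace ℝ (Fin d)) (hx : x ∈ Metric.ball (0 : EuclideanSpace ℝ (Fin d)) r)
    (hdiff : DifferentiableAt ℝ v x) :
    ‖gradient v x‖ ≤
      2 / r * sSup ((fun y => |v y|) '' Metric.ball (0 : EuclideanSpace ℝ (Fin d)) (2 * r))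
        + M * r / 2 := by
  set g := gradient v x with hg
  set S := sSup ((fun y => |v y|) '' Metric.ball (0 : EuclideanSpace ℝ (Fin d)) (2 * r)) with hS
  have hbdd : BddAbove ((fun y => |v y|) '' Metric.ball (0 : EuclideanSpace ℝ (Fin d)) (2 * r)) := by
    have h1 := (isCompact_closedBall (0 : EuclideanSpace ℝ (Fin d)) (2 * r)).bddAbove_image
      (hcont.abs.continuousOn)
    exact h1.mono (Set.image_mono Metric.ball_subset_closedBall)
  have hle : ∀ y, ‖y‖ < 2 * r → |v y| ≤ S := fun y hy =>
    le_csSup hbdd ⟨y, by simpa using hy, rfl⟩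
  have hxr : ‖x‖ < r := by simpa using hx
  have hS0 : 0 ≤ S := (abs_nonneg _).trans (hle x (by linarith))
  by_cases hg0 : ‖g‖ = 0
  · rw [hg0]; positivity
  have hgpos : 0 < ‖g‖ := lt_of_le_of_ne (norm_nonneg _) (Ne.symm hg0)
  set w : EuclideanSpace ℝ (Fin d) := (r / ‖g‖) • g with hw
  have hwn : ‖w‖ = r := by
    rw [hw, norm_smul, Real.norm_of_nonneg (by positivity)]
    field_simp
  have hgw : inner ℝ g w = r * ‖g‖ := by
    rw [hw, inner_smul_right, real_inner_self_eq_norm_sq]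
    field_simp
  have key : ∀ t : ℝ, 0 < t → t < 1 →
      t⁻¹ * (v (x + t • w) - v x) ≤ v (x + w) - v x + M / 2 * r ^ 2 := by
    intro t h0 h1
    have h := hconv.2 (Set.mem_univ x) (Set.mem_univ (x + w)) (sub_nonneg.2 h1.le) h0.le (by ring)
    have e : (1 - t) • x + t • (x + w) = x + t • w := by module
    simp only [e, smul_eq_mul] at h
    rw [norm_add_sq_real, norm_add_sq_real, inner_smul_right, norm_smul,
      Real.norm_of_nonneg h0.le, hwn] at h
    rw [inv_mul_le_iff₀ h0]
    have : 0 ≤ M / 2 * (t * r) ^ 2 := by positivity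
    nlinarith
  have hd : HasDerivAt (fun t : ℝ => v (x + t • w)) (r * ‖g‖) 0 := by
    have h1 : HasFDerivAt v (fderiv ℝ v x) (x + (0 : ℝ) • w) := by
      simpa using hdiff.hasFDerivAt
    have h2 : HasDerivAt (fun t : ℝ => x + t • w) w 0 := by
      simpa using ((hasDerivAt_id (0 : ℝ)).smul_const w).const_add x
    have h3 := h1.comp_hasDerivAt (0 : ℝ) h2
    have h4 : fderiv ℝ v x w = r * ‖g‖ := by
      rw [← hgw, hg, gradient, InnerProductSpace.toDual_symm_apply]
    rw [h4] at h3
    exact h3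
  have hlim := hd.tendsto_slope_zero_right
  have hfin : r * ‖g‖ ≤ v (x + w) - v x + M / 2 * r ^ 2 := by
    refine le_of_tendsto hlim ?_
    filter_upwards [Ioo_mem_nhdsGT (zero_lt_one (α := ℝ))] with t ht
    simpa using key t ht.1 ht.2
  have hxw : ‖x + w‖ < 2 * r := by
    have := norm_add_le x w
    linarith
  have a1 := (abs_le.1 (hle _ hxw)).2
  have a2 := (abs_le.1 (hle x (by linarith))).1
  have : r * ‖g‖ ≤ r * (2 / r * S + M * r / 2) := by
    have e : r * (2 / r * S + M * r / 2) = 2 * S + M / 2 * r ^ 2 := by field_simp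
    rw [e]; linarith
  exact le_of_mul_le_mul_left this hr
end

section
/- (Lemma 5.1.) Let M > 0, r > 0, and let v : ℝ^d → ℝ be continuous with x ↦ v(x) + (M/2)‖x‖² convex. Set r' := (2/(Mr)) · sup_{B_{2r}} |v| + r/2. Then for every x in the open ball B_r at which v is differentiable, one has ‖∇v(x)‖ ≤ 2 ( M · sup_{B_{r+r'}} |v| )^{1/2}. -/
theorem semiconvex_grad_ineq {d : ℕ} {M : ℝ}
    {v : EuclideanSpace ℝ (Fin d) → ℝ}
    (hconv : ConvexOn ℝ Set.univ (fun x => v x + M / 2 * ‖x‖ ^ 2))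
    {x : EuclideanSpace ℝ (Fin d)} (hdiff : DifferentiableAt ℝ v x)
    (h : EuclideanSpace ℝ (Fin d)) :
    inner ℝ (gradient v x) h - M / 2 * ‖h‖ ^ 2 ≤ v (x + h) - v x := by
  have hc : ConvexOn ℝ Set.univ
      (fun s : ℝ => v (x + s • h) + M / 2 * ‖x + s • h‖ ^ 2) := by
    have := hconv.comp_affineMap (AffineMap.lineMap (k := ℝ) x (x + h))
    simp only [Set.preimage_univ] at this
    have e : (fun s : ℝ => v (x + s • h) + M / 2 * ‖x + s • h‖ ^ 2) =
        (fun x => v x + M / 2 * ‖x‖ ^ 2) ∘ (AffineMap.lineMap (k := ℝ) x (x + h)) := by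
      funext s
      simp [AffineMap.lineMap_apply, add_comm]
    rw [e]
    exact this
  have hl : HasDerivAt (fun s : ℝ => x + s • h) h 0 := by
    simpa using ((hasDerivAt_id (0 : ℝ)).smul_const h).const_add x
  have hv : HasDerivAt (fun s : ℝ => v (x + s • h)) (inner ℝ (gradient v x) h) 0 := by
    have h1 : HasFDerivAt v (InnerProductSpace.toDual ℝ _ (gradient v x)) (x + (0 : ℝ) • h) := by
      simpa using hdiff.hasGradientAt.hasFDerivAt
    exact h1.comp_hasDerivAt (0 : ℝ) hl
  have hn : HasDerivAt (fun s : ℝ => ‖x + s • h‖ ^ 2) (2 * inner ℝ x h) 0 := by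
    simpa using hl.norm_sq
  have hd := hv.add (hn.const_mul (M / 2))
  have := hc.le_slope_of_hasDerivAt (Set.mem_univ 0) (Set.mem_univ 1) one_pos hd
  simp only [slope_def_field, one_smul, zero_smul, add_zero, sub_zero, div_one] at this
  rw [norm_add_sq_real] at this
  linarith

theorem le_sSup_abs_ball {d : ℕ} {v : EuclideanSpace ℝ (Fin d) → ℝ} (hcont : Continuous v)
    (ρ : ℝ) {y : EuclideanSpace ℝ (Fin d)} (hy : ‖y‖ < ρ) :
    |v y| ≤ sSup ((fun y => |v y|) '' Metric.ball (0 : EuclideanSpace ℝ (Fin d)) ρ) := by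
  apply le_csSup
  · exact ((isCompact_closedBall (0 : EuclideanSpace ℝ (Fin d)) ρ).bddAbove_image
      hcont.abs.continuousOn).mono (Set.image_mono Metric.ball_subset_closedBall)
  · exact ⟨y, by simpa using hy, rfl⟩

/-- Lemma 5.1: for `v` continuous with `v + (M/2)‖·‖²` convex (`M > 0`), setting
`r' := (2/(Mr)) · sup_{B_{2r}} |v| + r/2`, at every point `x ∈ B_r` of differentiability
one has `‖∇v(x)‖ ≤ 2 √(M · sup_{B_{r+r'}} |v|)`. -/
theorem semiconvex_gradient_bound_sqrt
    (d : ℕ) (M r : ℝ) (hM : 0 < M) (hr : 0 < r)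
    (v : EuclideanSpace ℝ (Fin d) → ℝ) (hcont : Continuous v)
    (hconv : ConvexOn ℝ Set.univ (fun x => v x + M / 2 * ‖x‖ ^ 2))
    (r' : ℝ)
    (hr' : r' = 2 / (M * r) *
      sSup ((fun y => |v y|) '' Metric.ball (0 : EuclideanSpace ℝ (Fin d)) (2 * r)) + r / 2)
    (x : EuclideanSpace ℝ (Fin d)) (hx : x ∈ Metric.ball (0 : EuclideanSpace ℝ (Fin d)) r)
    (hdiff : DifferentiableAt ℝ v x) :
    ‖gradient v x‖ ≤
      2 * Real.sqrt (M *
        sSup ((fun y => |v y|) '' Metric.ball (0 : EuclideanSpace ℝ (Fin d)) (r + r'))) := by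
  have hx' : ‖x‖ < r := by simpa using hx
  set g := gradient v x with hg
  have key := fun h => semiconvex_grad_ineq hconv hdiff h
  rw [← hg] at key
  set S0 := sSup ((fun y => |v y|) '' Metric.ball (0 : EuclideanSpace ℝ (Fin d)) (2 * r)) with hS0
  set S := sSup ((fun y => |v y|) '' Metric.ball (0 : EuclideanSpace ℝ (Fin d)) (r + r')) with hS
  by_cases hg0 : g = 0
  · rw [hg0, norm_zero]; positivity
  have hG : 0 < ‖g‖ := norm_pos_iff.mpr hg0
  have h1 : ‖g‖ / M ≤ r' := by
    have hn : ‖(r / ‖g‖) • g‖ = r := by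
      rw [norm_smul, Real.norm_of_nonneg (by positivity)]; field_simp
    have k := key ((r / ‖g‖) • g)
    rw [hn, real_inner_smul_right, real_inner_self_eq_norm_sq] at k
    have e : r / ‖g‖ * ‖g‖ ^ 2 = r * ‖g‖ := by field_simp
    rw [e] at k
    have a := le_sSup_abs_ball hcont (2 * r) (y := x) (by linarith)
    have b := le_sSup_abs_ball hcont (2 * r) (y := x + (r / ‖g‖) • g)
      (by have := norm_add_le x ((r / ‖g‖) • g); linarith)
    rw [← hS0] at a b
    have a' := neg_abs_le (v x)
    have b' := le_abs_self (v (x + (r / ‖g‖) • g))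
    have e2 : r' = (2 * S0 + M / 2 * r ^ 2) / r / M := by rw [hr']; field_simp
    rw [e2]
    gcongr
    rw [le_div_iff₀ hr]
    linarith
  have hn : ‖(1 / M) • g‖ = ‖g‖ / M := by
    rw [norm_smul, Real.norm_of_nonneg (by positivity)]; field_simp
  have k := key ((1 / M) • g)
  rw [hn, real_inner_smul_right, real_inner_self_eq_norm_sq] at k
  have hp : 0 < ‖g‖ / M := by positivity
  have a := le_sSup_abs_ball hcont (r + r') (y := x) (by linarith)
  have b := le_sSup_abs_ball hcont (r + r') (y := x + (1 / M) • g)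
    (by have := norm_add_le x ((1 / M) • g); linarith)
  rw [← hS] at a b
  have a' := neg_abs_le (v x)
  have b' := le_abs_self (v (x + (1 / M) • g))
  have e : 1 / M * ‖g‖ ^ 2 - M / 2 * (‖g‖ / M) ^ 2 = ‖g‖ ^ 2 / (2 * M) := by field_simp; ring
  rw [e] at k
  have k2 : ‖g‖ ^ 2 / (2 * M) ≤ 2 * S := by linarith
  rw [div_le_iff₀ (by positivity)] at k2
  have : ‖g‖ / 2 ≤ Real.sqrt (M * S) := Real.le_sqrt_of_sq_le (by nlinarith)
  linarith
end

section
/- Let M > 0, ε ≥ 0, and let v : ℝ^d → ℝ be differentiable with x ↦ v(x) + (M/2)‖x‖² convex and |v(x)| ≤ ε for all x ∈ ℝ^d. Then ‖∇v(x)‖ ≤ 2 (M ε)^{1/2} for all x ∈ ℝ^d. -/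
/-- Global form of Lemma 5.1: if `v` is differentiable, `v + (M/2)‖·‖²` is convex
(`M > 0`) and `|v| ≤ ε` everywhere, then `‖∇v‖ ≤ 2 √(Mε)` everywhere. -/
theorem semiconvex_global_gradient_bound
    (d : ℕ) (M ε : ℝ) (hM : 0 < M) (hε : 0 ≤ ε)
    (v : EuclideanSpace ℝ (Fin d) → ℝ) (hdiff : Differentiable ℝ v)
    (hconv : ConvexOn ℝ Set.univ (fun x => v x + M / 2 * ‖x‖ ^ 2))
    (hbound : ∀ x, |v x| ≤ ε) :
    ∀ x, ‖gradient v x‖ ≤ 2 * Real.sqrt (M * ε) := by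
  intro x
  set g := gradient v x with hg
  have hline : HasDerivAt (fun t : ℝ => x + t • (M⁻¹ • g)) (M⁻¹ • g) 0 := by
    simpa using ((hasDerivAt_id (0 : ℝ)).smul_const (M⁻¹ • g)).const_add x
  have hgrad : HasFDerivAt v (InnerProductSpace.toDual ℝ _ g) (x + (0 : ℝ) • (M⁻¹ • g)) := by
    rw [zero_smul, add_zero]
    exact (hdiff x).hasGradientAt.hasFDerivAt
  have h1 := hgrad.comp_hasDerivAt (0 : ℝ) hline
  have h2 := (hline.norm_sq).const_mul (M / 2)
  have h3 := h1.add h2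
  have hc : ConvexOn ℝ Set.univ
      (fun t : ℝ => v (x + t • (M⁻¹ • g)) + M / 2 * ‖x + t • (M⁻¹ • g)‖ ^ 2) := by
    refine ⟨convex_univ, fun a _ b _ p q hp hq hpq => ?_⟩
    have := hconv.2 (Set.mem_univ (x + a • (M⁻¹ • g))) (Set.mem_univ (x + b • (M⁻¹ • g))) hp hq hpq
    have e : p • (x + a • (M⁻¹ • g)) + q • (x + b • (M⁻¹ • g))
        = x + (p • a + q • b) • (M⁻¹ • g) := by
      obtain rfl : q = 1 - p := by linarith
      simp only [smul_eq_mul]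
      module
    simpa only [e] using this
  have h4 := hc.le_slope_of_hasDerivAt (Set.mem_univ 0) (Set.mem_univ 1) one_pos h3
  simp only [slope_def_field, InnerProductSpace.toDual_apply_apply, zero_smul, add_zero, one_smul,
    inner_smul_right, real_inner_self_eq_norm_sq, sub_zero, div_one] at h4
  rw [norm_add_sq_real, inner_smul_right, norm_smul, Real.norm_of_nonneg (by positivity)] at h4
  have h5 := abs_le.1 (hbound x)
  have h6 := abs_le.1 (hbound (x + M⁻¹ • g))
  have h7 : M⁻¹ * ‖g‖ ^ 2 - M / 2 * (M⁻¹ * ‖g‖) ^ 2 ≤ 2 * ε := by linarith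
  have h8 : M⁻¹ * ‖g‖ ^ 2 - M / 2 * (M⁻¹ * ‖g‖) ^ 2 = ‖g‖ ^ 2 / (2 * M) := by
    field_simp
    ring
  rw [h8, div_le_iff₀ (by positivity)] at h7
  have h9 := Real.sq_sqrt (show 0 ≤ M * ε by positivity)
  refine abs_le_of_sq_le_sq' ?_ (by positivity) |>.2
  rw [mul_pow, h9]
  linarith
end

section
/- (Theorem 6.1, honest form via the final Remark.) Let g : ℝ^d → ℝ be convex, continuously differentiable, and coercive (g(x) → +∞ as ‖x‖ → ∞), and let F := argmin g, which is then nonempty, compact and convex. Let C ≥ 0, λ > 0, and let f : [0,∞) × ℝ^d → ℝ^d be continuous with ‖f(t, x) − ∇g(x)‖ ≤ C e^{−λ t} for all t ≥ 0 and x ∈ ℝ^d. Let x : [0,∞) → ℝ^d be differentiable with ẋ(t) = −f(t, x(t)) for all t > 0. Then x(t) converges as t → ∞ to some point y_∞ ∈ F, i.e., to a global minimizer of g. -/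
open Filter

theorem convex_grad_ineq {d : ℕ} {g : EuclideanSpace ℝ (Fin d) → ℝ}
    (hgconv : ConvexOn ℝ Set.univ g) (hgC1 : ContDiff ℝ 1 g)
    (x z : EuclideanSpace ℝ (Fin d)) :
    inner ℝ (gradient g x) (z - x) ≤ g z - g x := by
  have hd : HasGradientAt g (gradient g x) x :=
    (hgC1.differentiable (by norm_num) x).hasGradientAt
  have hc : ConvexOn ℝ Set.univ (g ∘ (AffineMap.lineMap x z : ℝ →ᵃ[ℝ] _)) := by
    simpa using hgconv.comp_affineMap (AffineMap.lineMap x z : ℝ →ᵃ[ℝ] _)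
  have hd' : HasDerivAt (g ∘ (AffineMap.lineMap x z : ℝ →ᵃ[ℝ] _))
      (inner ℝ (gradient g x) (z - x)) (0 : ℝ) := by
    have h1 : HasFDerivAt g (InnerProductSpace.toDual ℝ _ (gradient g x))
        ((AffineMap.lineMap x z : ℝ →ᵃ[ℝ] _) (0 : ℝ)) := by
      simpa using hd.hasFDerivAt
    have h2 := h1.comp_hasDerivAt (0 : ℝ) (AffineMap.hasDerivAt_lineMap (a := x) (b := z))
    simpa using h2
  have h := hc.le_slope_of_hasDerivAt (Set.mem_univ 0) (Set.mem_univ 1) one_pos hd'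
  simpa [slope_def_field] using h

theorem lyapunov_antitone {d : ℕ} {g : EuclideanSpace ℝ (Fin d) → ℝ}
    (hgconv : ConvexOn ℝ Set.univ g) (hgC1 : ContDiff ℝ 1 g)
    (C lam : ℝ) (hC : 0 ≤ C) (hlam : 0 < lam)
    (f : ℝ → EuclideanSpace ℝ (Fin d) → EuclideanSpace ℝ (Fin d))
    (hfapprox : ∀ t : ℝ, 0 ≤ t → ∀ x, ‖f t x - gradient g x‖ ≤ C * Real.exp (-lam * t))
    (x : ℝ → EuclideanSpace ℝ (Fin d))
    (hxcont : ContinuousOn x (Set.Ici (0 : ℝ)))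
    (hode : ∀ t : ℝ, 0 < t → HasDerivAt x (-(f t (x t))) t)
    (z : EuclideanSpace ℝ (Fin d)) (ε T : ℝ) (hε : 0 ≤ ε) (hT : 0 ≤ T)
    (hz : ∀ t, T < t → g z + ε ≤ g (x t)) :
    AntitoneOn (fun t => (1 + ‖x t - z‖ ^ 2) * Real.exp (C / lam * Real.exp (-lam * t))
      + 2 * ε * t) (Set.Ici T) := by
  have hE : ∀ t, HasDerivAt (fun t => Real.exp (C / lam * Real.exp (-lam * t)))
      (-(Real.exp (C / lam * Real.exp (-lam * t)) * (C * Real.exp (-lam * t)))) t := by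
    intro t
    have h1 : HasDerivAt (fun t => -lam * t) (-lam) t := by
      simpa using (hasDerivAt_id t).const_mul (-lam)
    convert ((h1.exp).const_mul (C / lam)).exp using 1
    field_simp
  have hL : ∀ t, 0 < t → HasDerivAt (fun t => (1 + ‖x t - z‖ ^ 2) *
      Real.exp (C / lam * Real.exp (-lam * t)) + 2 * ε * t)
      ((2 * inner ℝ (x t - z) (-(f t (x t)))) * Real.exp (C / lam * Real.exp (-lam * t))
       + (1 + ‖x t - z‖ ^ 2) *
        (-(Real.exp (C / lam * Real.exp (-lam * t)) * (C * Real.exp (-lam * t))))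
       + 2 * ε) t := by
    intro t ht
    have h1 := (((hode t ht).sub_const z).norm_sq).const_add 1
    have h2 : HasDerivAt (fun t => 2 * ε * t) (2 * ε) t := by
      simpa using (hasDerivAt_id t).const_mul (2 * ε)
    exact (h1.mul (hE t)).add h2
  refine antitoneOn_of_hasDerivWithinAt_nonpos (convex_Ici T) ?_
    (fun t ht => (hL t ?_).hasDerivWithinAt) ?_
  · have hx' : ContinuousOn x (Set.Ici T) := hxcont.mono (Set.Ici_subset_Ici.2 hT)
    have hE' : Continuous (fun t => Real.exp (C / lam * Real.exp (-lam * t))) := by fun_prop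
    fun_prop
  · rw [interior_Ici] at ht
    exact lt_of_le_of_lt hT ht
  · intro t ht
    rw [interior_Ici] at ht
    have ht' : T < t := ht
    have ht0 : 0 < t := lt_of_le_of_lt hT ht'
    have hz' := hz t ht'
    have hg := convex_grad_ineq hgconv hgC1 (x t) z
    have ha := hfapprox t ht0.le (x t)
    set e := C * Real.exp (-lam * t) with he
    have he0 : 0 ≤ e := by positivity
    set E := Real.exp (C / lam * Real.exp (-lam * t)) with hEdef
    have hE1 : 1 ≤ E := Real.one_le_exp (by positivity)
    have hcs : - inner ℝ (x t - z) (f t (x t) - gradient g (x t)) ≤ ‖x t - z‖ * e := by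
      have := abs_real_inner_le_norm (x t - z) (f t (x t) - gradient g (x t))
      have h2 := neg_le_abs (inner ℝ (x t - z) (f t (x t) - gradient g (x t)))
      have h3 := mul_le_mul_of_nonneg_left ha (norm_nonneg (x t - z))
      linarith
    rw [inner_sub_right] at hcs
    have hg2 : inner ℝ (gradient g (x t)) (z - x t) = - inner ℝ (x t - z) (gradient g (x t)) := by
      rw [← neg_sub, inner_neg_right, real_inner_comm]
    rw [hg2] at hg
    rw [inner_neg_right]
    set r := ‖x t - z‖
    set I := inner ℝ (x t - z) (f t (x t))
    have key : 2 * (-I) - (1 + r ^ 2) * e ≤ - (2 * ε) := by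
      nlinarith [mul_nonneg he0 (sq_nonneg (r - 1))]
    nlinarith [mul_le_mul_of_nonneg_left key (by linarith : 0 ≤ E), mul_nonneg hε (by linarith : 0 ≤ E - 1)]

/-- Theorem 6.1 (honest form): let `g` be convex, `C¹` and coercive on `ℝ^d`, and let
`F := argmin g`. If `f(t,·)` approximates `∇g` exponentially fast in time, i.e.
`‖f(t,x) − ∇g(x)‖ ≤ C e^{−λt}`, then `F` is nonempty, compact and convex, and every
solution of the non-autonomous gradient flow `ẋ(t) = −f(t, x(t))` converges as `t → ∞`
to some global minimizer `y_∞ ∈ F` of `g`. -/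
theorem gradient_flow_converges_to_minimizer
    (d : ℕ) (g : EuclideanSpace ℝ (Fin d) → ℝ)
    (hgconv : ConvexOn ℝ Set.univ g) (hgC1 : ContDiff ℝ 1 g)
    (hgcoer : Tendsto g (cocompact (EuclideanSpace ℝ (Fin d))) atTop)
    (F : Set (EuclideanSpace ℝ (Fin d)))
    (hF : F = { z | ∀ w, g z ≤ g w })
    (C lam : ℝ) (hC : 0 ≤ C) (hlam : 0 < lam)
    (f : ℝ → EuclideanSpace ℝ (Fin d) → EuclideanSpace ℝ (Fin d))
    (hfcont : ContinuousOn (fun p : ℝ × EuclideanSpace ℝ (Fin d) => f p.1 p.2)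
      (Set.Ici (0 : ℝ) ×ˢ Set.univ))
    (hfapprox : ∀ t : ℝ, 0 ≤ t → ∀ x, ‖f t x - gradient g x‖ ≤ C * Real.exp (-lam * t))
    (x : ℝ → EuclideanSpace ℝ (Fin d))
    (hxcont : ContinuousOn x (Set.Ici (0 : ℝ)))
    (hode : ∀ t : ℝ, 0 < t → HasDerivAt x (-(f t (x t))) t) :
    F.Nonempty ∧ IsCompact F ∧ Convex ℝ F ∧
      ∃ y ∈ F, Tendsto x atTop (nhds y) := by
  have hcont : Continuous g := hgC1.continuous
  obtain ⟨z, hz⟩ := hcont.exists_forall_le hgcoer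
  have hFz : F = {w | g w ≤ g z} := by
    rw [hF]; ext w
    exact ⟨fun h => h z, fun h v => le_trans h (hz v)⟩
  have hzF : z ∈ F := by rw [hFz]; exact le_refl (g z)
  refine ⟨⟨z, hzF⟩, ?_, ?_, ?_⟩
  · have h1 := hgcoer.eventually (eventually_gt_atTop (g z))
    obtain ⟨K, hK, hKs⟩ := mem_cocompact.1 h1
    refine hK.of_isClosed_subset ?_ ?_
    · rw [hFz]; exact isClosed_le hcont continuous_const
    · intro w hw
      by_contra hwK
      have h2 : g z < g w := hKs hwK
      rw [hFz] at hw
      exact absurd h2 (not_lt.2 hw)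
  · rw [hFz]
    simpa using hgconv.convex_le (g z)
  have hanti := lyapunov_antitone hgconv hgC1 C lam hC hlam f hfapprox x hxcont hode
  have hE1 : ∀ t, 1 ≤ Real.exp (C / lam * Real.exp (-lam * t)) :=
    fun t => Real.one_le_exp (by positivity)
  have hmin : ∀ y ∈ F, ∀ w, g y ≤ g w := by
    intro y hy; rw [hF] at hy; exact hy
  -- convergence of the distance to every minimizer
  have hlim : ∀ y ∈ F, ∃ l, Tendsto (fun t => ‖x t - y‖ ^ 2) atTop (nhds l) := by
    intro y hy
    have hA := hanti y 0 0 le_rfl le_rfl (fun t _ => by simpa using hmin y hy (x t))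
    simp only [mul_zero, zero_mul, add_zero] at hA
    set L := fun t => (1 + ‖x t - y‖ ^ 2) * Real.exp (C / lam * Real.exp (-lam * t)) with hLdef
    have hL' : Antitone (fun t => L (max t 0)) := fun a b hab =>
      hA (Set.mem_Ici.2 (le_max_right _ _)) (Set.mem_Ici.2 (le_max_right _ _)) (max_le_max_right 0 hab)
    have hb : BddBelow (Set.range (fun t => L (max t 0))) := by
      refine ⟨0, ?_⟩
      rintro _ ⟨t, rfl⟩
      simp only [hLdef]
      positivity
    have h1 := tendsto_atTop_ciInf hL' hb
    set l := ⨅ t, L (max t 0)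
    have h2 : Tendsto L atTop (nhds l) := by
      refine h1.congr' ?_
      filter_upwards [eventually_ge_atTop 0] with t ht
      rw [max_eq_left ht]
    have h3 : Tendsto (fun t => Real.exp (C / lam * Real.exp (-lam * t))) atTop (nhds 1) := by
      have h4 : Tendsto (fun t : ℝ => -lam * t) atTop atBot :=
        tendsto_id.const_mul_atTop_of_neg (by linarith)
      have h5 := ((Real.tendsto_exp_atBot.comp h4).const_mul (C / lam))
      have h6 := (Real.continuous_exp.tendsto _).comp h5
      simpa [Function.comp_def] using h6
    refine ⟨l / 1 - 1, ((h2.div h3 one_ne_zero).sub_const 1).congr ?_⟩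
    intro t
    have := hE1 t
    simp only [hLdef, Pi.div_apply]
    rw [mul_div_cancel_right₀ _ (by positivity)]
    ring
  -- the values come close to the minimum at arbitrarily late times
  have hfreq : ∀ n : ℕ, ∃ t : ℝ, (n : ℝ) ≤ t ∧ g (x t) < g z + 1 / ((n : ℝ) + 1) := by
    intro n
    by_contra! hcon
    have hε : (0 : ℝ) < 1 / ((n : ℝ) + 1) := by positivity
    have hA := hanti z _ n hε.le n.cast_nonneg (fun t ht => hcon t ht.le)
    set ε := 1 / ((n : ℝ) + 1)
    set M := (1 + ‖x n - z‖ ^ 2) * Real.exp (C / lam * Real.exp (-lam * n)) + 2 * ε * n with hM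
    have hM0 : 0 ≤ M := by positivity
    have hle : (n : ℝ) ≤ n + M / ε := by
      have : 0 ≤ M / ε := by positivity
      linarith
    have h := hA (Set.mem_Ici.2 le_rfl) (Set.mem_Ici.2 hle) hle
    simp only [] at h
    rw [← hM] at h
    have h7 : 2 * ε * (n + M / ε) = 2 * ε * n + 2 * M := by field_simp
    rw [h7] at h
    have h8 := hE1 (n + M / ε)
    have h9 : 0 < (1 + ‖x (n + M / ε) - z‖ ^ 2) *
      Real.exp (C / lam * Real.exp (-lam * (n + M / ε))) := by positivity
    have h10 : 0 ≤ 2 * ε * n := by positivity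
    linarith
  choose τ hτ1 hτ2 using hfreq
  have hτ : Tendsto τ atTop atTop := tendsto_atTop_mono hτ1 tendsto_natCast_atTop_atTop
  -- boundedness and a cluster point
  obtain ⟨l, hl⟩ := hlim z hzF
  have hev : ∀ᶠ n in atTop, x (τ n) ∈ Metric.closedBall z (l + 2) := by
    filter_upwards [(hl.comp hτ).eventually (eventually_lt_nhds (lt_add_one l))] with n hn
    simp only [Function.comp] at hn
    rw [Metric.mem_closedBall, dist_eq_norm]
    nlinarith [sq_nonneg (‖x (τ n) - z‖ - 1)]
  obtain ⟨y, -, φ, hφ, hy⟩ :=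
    tendsto_subseq_of_frequently_bounded Metric.isBounded_closedBall hev.frequently
  have hgy : g y ≤ g z := by
    have h1 : Tendsto (fun n => g (x (τ (φ n)))) atTop (nhds (g y)) :=
      (hcont.tendsto y).comp hy
    have h2 : Tendsto (fun n => g z + 1 / (((φ n : ℕ) : ℝ) + 1)) atTop (nhds (g z + 0)) :=
      ((tendsto_one_div_add_atTop_nhds_zero_nat (𝕜 := ℝ)).comp hφ.tendsto_atTop).const_add _
    rw [add_zero] at h2
    exact le_of_tendsto_of_tendsto' h1 h2 (fun n => (hτ2 (φ n)).le)
  have hyF : y ∈ F := by rw [hFz]; exact hgy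
  refine ⟨y, hyF, ?_⟩
  obtain ⟨m, hm⟩ := hlim y hyF
  have h1 := hm.comp (hτ.comp hφ.tendsto_atTop)
  have h2 : Tendsto (fun n => ‖x (τ (φ n)) - y‖ ^ 2) atTop (nhds 0) := by
    have := ((tendsto_iff_norm_sub_tendsto_zero.1 hy).pow 2)
    simpa [Function.comp_def] using this
  have hm0 : m = 0 := tendsto_nhds_unique h1 h2
  rw [hm0] at hm
  rw [tendsto_iff_norm_sub_tendsto_zero]
  have h3 := hm.sqrt
  simpa using h3
end

section
/- Let g : ℝ^d → ℝ be convex, continuously differentiable, and coercive (g(x) → +∞ as ‖x‖ → ∞), and let F := argmin g, which is then nonempty, compact and convex. Let f : [0,∞) × ℝ^d → ℝ^d be continuous and suppose the function t ↦ sup_{x ∈ ℝ^d} ‖f(t, x) − ∇g(x)‖ is integrable on [0,∞). Let x : [0,∞) → ℝ^d be differentiable with ẋ(t) = −f(t, x(t)) for all t > 0. Then x(t) converges as t → ∞ to some point of F, i.e., to a global minimizer of g. -/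
open Filter MeasureTheory

/-- First-order convexity inequality. -/
lemma aux_grad_ineq {d : ℕ} {g : EuclideanSpace ℝ (Fin d) → ℝ}
    (hgconv : ConvexOn ℝ Set.univ g) (hg : Differentiable ℝ g)
    (a z : EuclideanSpace ℝ (Fin d)) :
    g a - g z ≤ inner ℝ (a - z) (gradient g a) := by
  have hc : ConvexOn ℝ Set.univ (fun s : ℝ => g (AffineMap.lineMap a z s)) := by
    have := hgconv.comp_affineMap (AffineMap.lineMap (k := ℝ) a z)
    rw [Set.preimage_univ] at this
    exact this
  have hd : HasDerivAt (fun s : ℝ => g (AffineMap.lineMap a z s)) (fderiv ℝ g a (z - a)) 0 := by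
    have h1 : HasDerivAt (fun s : ℝ => (AffineMap.lineMap a z s : EuclideanSpace ℝ (Fin d)))
        (z - a) 0 := AffineMap.hasDerivAt_lineMap
    have h2 : HasFDerivAt g (fderiv ℝ g a) (AffineMap.lineMap a z (0 : ℝ)) := by
      simpa using (hg a).hasFDerivAt
    exact h2.comp_hasDerivAt (0 : ℝ) h1
  have h := hc.le_slope_of_hasDerivAt (Set.mem_univ 0) (Set.mem_univ 1) zero_lt_one hd
  simp [slope_def_field] at h
  have h3 : inner ℝ (gradient g a) (z - a) = fderiv ℝ g a (z - a) := by
    simp [gradient]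
  have h4 : inner ℝ (a - z) (gradient g a) = - inner ℝ (gradient g a) (z - a) := by
    rw [real_inner_comm, ← neg_sub z a, inner_neg_right]
  rw [h4, h3]
  simp only [map_sub]
  linarith

/-- Core: perturbed flow with continuous error whose norm primitive is bounded. -/
lemma aux_core {d : ℕ} {g : EuclideanSpace ℝ (Fin d) → ℝ}
    (hgconv : ConvexOn ℝ Set.univ g) (hg : Differentiable ℝ g)
    {x r : ℝ → EuclideanSpace ℝ (Fin d)} {H : ℝ → ℝ} {B : ℝ}
    (hH : ∀ t, 0 < t → HasDerivAt H ‖r t‖ t)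
    (hHB : ∀ t, 0 ≤ t → H t ≤ B)
    (hode : ∀ t : ℝ, 0 < t → HasDerivAt x (-(gradient g (x t)) + r t) t)
    (z0 : EuclideanSpace ℝ (Fin d)) (hz0 : ∀ w, g z0 ≤ g w) :
    ∃ y, (∀ w, g y ≤ g w) ∧ Tendsto x atTop (nhds y) := by
  -- monotonicity of H
  have hHmono : MonotoneOn H (Set.Ici 1) := by
    refine monotoneOn_of_deriv_nonneg (convex_Ici 1) ?_ ?_ ?_
    · intro t ht
      exact (hH t (lt_of_lt_of_le one_pos ht)).continuousAt.continuousWithinAt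
    · intro t ht
      rw [interior_Ici] at ht
      exact (hH t (one_pos.trans ht)).differentiableAt.differentiableWithinAt
    · intro t ht
      rw [interior_Ici] at ht
      rw [(hH t (one_pos.trans ht)).deriv]
      exact norm_nonneg _
  obtain ⟨φ, hφ⟩ : ∃ φ : EuclideanSpace ℝ (Fin d) → ℝ → ℝ,
    φ = fun z t => √(1 + ‖x t - z‖ ^ 2) := ⟨_, rfl⟩
  have hφ1 : ∀ z t, 1 ≤ φ z t := by
    intro z t
    rw [hφ]
    exact Real.one_le_sqrt.2 (by nlinarith [sq_nonneg ‖x t - z‖])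
  have hφn : ∀ z t, ‖x t - z‖ ≤ φ z t := by
    intro z t
    rw [hφ]
    exact Real.le_sqrt_of_sq_le (by linarith)
  have hφd : ∀ z t, 0 < t → HasDerivAt (φ z)
      (inner ℝ (x t - z) (-(gradient g (x t)) + r t) / φ z t) t := by
    intro z t ht
    have h1 := (((hode t ht).sub_const z).norm_sq.const_add 1).sqrt (by positivity)
    rw [hφ]
    convert h1 using 1
    rw [mul_div_mul_left _ _ two_ne_zero]
  have hφle : ∀ z t, inner ℝ (x t - z) (-(gradient g (x t)) + r t) / φ z t ≤
      - ((g (x t) - g z) / φ z t) + ‖r t‖ := by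
    intro z t
    have hp : 0 < φ z t := one_pos.trans_le (hφ1 z t)
    rw [← neg_div, div_add' _ _ _ hp.ne']
    refine div_le_div_of_nonneg_right ?_ hp.le
    rw [inner_add_right, inner_neg_right]
    have h1 := aux_grad_ineq hgconv hg (x t) z
    have h2 := real_inner_le_norm (x t - z) (r t)
    have h3 := mul_le_mul_of_nonneg_right (hφn z t) (norm_nonneg (r t))
    linarith
  -- general antitone principle
  have hanti : ∀ z (c T : ℝ), 1 ≤ T → (∀ t, T ≤ t → c ≤ (g (x t) - g z) / φ z t) →
      AntitoneOn (fun t => φ z t - H t + c * t) (Set.Ici T) := by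
    intro z c T hT hc
    have hd : ∀ t, T ≤ t → HasDerivAt (fun t => φ z t - H t + c * t)
        (inner ℝ (x t - z) (-(gradient g (x t)) + r t) / φ z t - ‖r t‖ + c * 1) t := by
      intro t ht
      have ht0 : 0 < t := by linarith
      exact ((hφd z t ht0).sub (hH t ht0)).add ((hasDerivAt_id t).const_mul c)
    refine antitoneOn_of_deriv_nonpos (convex_Ici T) ?_ ?_ ?_
    · intro t ht
      exact (hd t ht).continuousAt.continuousWithinAt
    · intro t ht
      rw [interior_Ici] at ht
      exact (hd t ht.le).differentiableAt.differentiableWithinAt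
    · intro t ht
      rw [interior_Ici] at ht
      rw [(hd t ht.le).deriv]
      have := hφle z t
      have := hc t ht.le
      linarith
  have hanti0 : ∀ z, (∀ w, g z ≤ g w) → AntitoneOn (fun t => φ z t - H t) (Set.Ici 1) := by
    intro z hz
    have := hanti z 0 1 le_rfl (fun t _ =>
      div_nonneg (sub_nonneg.2 (hz _)) (zero_le_one.trans (hφ1 z t)))
    simpa using this
  -- boundedness
  obtain ⟨C, hC1, hC⟩ : ∃ C, 1 ≤ C ∧ ∀ t, 1 ≤ t → φ z0 t ≤ C := by
    have key : ∀ t, 1 ≤ t → φ z0 t ≤ φ z0 1 - H 1 + B := by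
      intro t ht
      have h1 := hanti0 z0 hz0 (Set.mem_Ici.2 le_rfl) (Set.mem_Ici.2 ht) ht
      have h2 := hHB t (by linarith)
      simp only at h1
      linarith
    exact ⟨_, (hφ1 z0 1).trans (key 1 le_rfl), key⟩
  -- recurrence
  have hrec : ∀ ε > 0, ∀ T, 1 ≤ T → ∃ t, T ≤ t ∧ g (x t) < g z0 + ε := by
    intro ε hε T hT
    by_contra! hcon
    have hCpos : 0 < C := by linarith
    have ha := hanti z0 (ε / C) T hT (by
      intro t ht
      have := hcon t ht
      exact div_le_div₀ (by linarith) (by linarith) (one_pos.trans_le (hφ1 _ _))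
        (hC t (hT.trans ht)))
    have hcpos : 0 < ε / C := by positivity
    obtain ⟨s, hs⟩ : ∃ s, s = T + (φ z0 T - H T + B) * (C / ε) := ⟨_, rfl⟩
    have hnn : 0 ≤ φ z0 T - H T + B := by
      have := hHB T (by linarith)
      have := hφ1 z0 T
      linarith
    have hsT : T ≤ s := by
      rw [hs]
      have : 0 ≤ (φ z0 T - H T + B) * (C / ε) := by positivity
      linarith
    have h1 := ha (Set.mem_Ici.2 le_rfl) (Set.mem_Ici.2 hsT) hsT
    simp only at h1
    have h2 : ε / C * s = ε / C * T + (φ z0 T - H T + B) := by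
      rw [hs]; field_simp
    have h3 := hHB s (by linarith)
    have h4 := hφ1 z0 s
    linarith
  -- sequence
  have hseq : ∀ n : ℕ, ∃ t, (n : ℝ) + 1 ≤ t ∧ g (x t) < g z0 + 1 / ((n : ℝ) + 1) := by
    intro n
    exact hrec _ (by positivity) _ (by have : (0 : ℝ) ≤ n := n.cast_nonneg
                                       linarith)
  choose τ hτ1 hτ2 using hseq
  have hτtop : Tendsto τ atTop atTop :=
    tendsto_atTop_mono (fun n => by linarith [hτ1 n]) tendsto_natCast_atTop_atTop
  obtain ⟨y, -, ψ, hψ, hy⟩ := (isCompact_closedBall z0 C).tendsto_subseq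
    (x := fun n => x (τ n)) (by
      intro n
      rw [mem_closedBall_iff_norm]
      refine (hφn z0 _).trans (hC _ ?_)
      have : (0 : ℝ) ≤ n := n.cast_nonneg
      linarith [hτ1 n])
  have hymin : ∀ w, g y ≤ g w := by
    intro w
    refine le_trans ?_ (hz0 w)
    have h1 : Tendsto (fun n => g (x (τ (ψ n)))) atTop (nhds (g y)) :=
      (hg.continuous.tendsto y).comp hy
    have h2 : Tendsto (fun n : ℕ => g z0 + 1 / (((ψ n : ℕ) : ℝ) + 1)) atTop (nhds (g z0 + 0)) :=
      (tendsto_one_div_add_atTop_nhds_zero_nat.comp hψ.tendsto_atTop).const_add _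
    rw [add_zero] at h2
    exact le_of_tendsto_of_tendsto' h1 h2 (fun n => (hτ2 (ψ n)).le)
  refine ⟨y, hymin, ?_⟩
  have hsub : Tendsto (fun n => τ (ψ n)) atTop atTop := hτtop.comp hψ.tendsto_atTop
  -- limits at infinity of H and of φ y - H
  have conv_mono : ∀ u : ℝ → ℝ, MonotoneOn u (Set.Ici 1) → (∃ M, ∀ t, 1 ≤ t → u t ≤ M) →
      ∃ l, Tendsto u atTop (nhds l) := by
    intro u hu ⟨M, hM⟩
    have hm : Monotone (fun t => u (max t 1)) := fun a b hab =>
      hu (Set.mem_Ici.2 (le_max_right _ _)) (Set.mem_Ici.2 (le_max_right _ _))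
        (max_le_max_right 1 hab)
    refine ⟨_, (tendsto_atTop_ciSup hm ⟨M, ?_⟩).congr' ?_⟩
    · rintro _ ⟨t, rfl⟩
      exact hM _ (le_max_right _ _)
    · filter_upwards [eventually_ge_atTop 1] with t ht
      rw [max_eq_left ht]
  obtain ⟨l1, hl1⟩ := conv_mono H hHmono ⟨B, fun t ht => hHB t (by linarith)⟩
  obtain ⟨l2, hl2⟩ := conv_mono (fun t => -(φ y t - H t)) (hanti0 y hymin).neg
    ⟨B, fun t ht => by linarith [hφ1 y t, hHB t (by linarith)]⟩
  have hl : Tendsto (φ y) atTop (nhds (l1 - l2)) := by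
    refine (hl1.sub hl2).congr (fun t => by ring)
  have hlim1 : Tendsto (fun n => φ y (τ (ψ n))) atTop (nhds 1) := by
    have h0 : Tendsto (fun n => x (τ (ψ n)) - y) atTop (nhds 0) := by
      simpa using hy.sub_const y
    have := ((h0.norm.pow 2).const_add 1).sqrt
    rw [hφ]
    simpa using this
  have hleq : l1 - l2 = 1 := tendsto_nhds_unique (hl.comp hsub) hlim1
  rw [hleq] at hl
  rw [tendsto_iff_norm_sub_tendsto_zero]
  have h5 := ((hl.pow 2).sub_const 1).sqrt
  simp only [one_pow, sub_self, Real.sqrt_zero] at h5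
  refine h5.congr (fun t => ?_)
  rw [hφ]
  simp only
  rw [Real.sq_sqrt (by positivity), add_sub_cancel_left, Real.sqrt_sq (norm_nonneg _)]

/-- Gradient-flow convergence under the integrability assumption of the final remark:
let `g` be convex, `C¹` and coercive on `ℝ^d` and `F := argmin g` (nonempty, compact,
convex). If `t ↦ sup_x ‖f(t,x) − ∇g(x)‖` is (well defined and) integrable on `[0,∞)`,
then every solution of `ẋ(t) = −f(t, x(t))` converges as `t → ∞` to a point of `F`. -/
theorem gradient_flow_converges_of_integrable_error
    (d : ℕ) (g : EuclideanSpace ℝ (Fin d) → ℝ)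
    (hgconv : ConvexOn ℝ Set.univ g) (hgC1 : ContDiff ℝ 1 g)
    (hgcoer : Tendsto g (cocompact (EuclideanSpace ℝ (Fin d))) atTop)
    (F : Set (EuclideanSpace ℝ (Fin d)))
    (hF : F = { z | ∀ w, g z ≤ g w })
    (f : ℝ → EuclideanSpace ℝ (Fin d) → EuclideanSpace ℝ (Fin d))
    (hfcont : ContinuousOn (fun p : ℝ × EuclideanSpace ℝ (Fin d) => f p.1 p.2)
      (Set.Ici (0 : ℝ) ×ˢ Set.univ))
    (hbdd : ∀ t : ℝ, 0 ≤ t → BddAbove (Set.range fun z => ‖f t z - gradient g z‖))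
    (hint : IntegrableOn (fun t => ⨆ z, ‖f t z - gradient g z‖) (Set.Ici (0 : ℝ)))
    (x : ℝ → EuclideanSpace ℝ (Fin d))
    (hxcont : ContinuousOn x (Set.Ici (0 : ℝ)))
    (hode : ∀ t : ℝ, 0 < t → HasDerivAt x (-(f t (x t))) t) :
    F.Nonempty ∧ IsCompact F ∧ Convex ℝ F ∧
      ∃ y ∈ F, Tendsto x atTop (nhds y) := by
  have hgd : Differentiable ℝ g := hgC1.differentiable one_ne_zero
  have hgc : Continuous g := hgC1.continuous
  have hgrad : Continuous (gradient g) :=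
    (InnerProductSpace.toDual ℝ (EuclideanSpace ℝ (Fin d))).symm.continuous.comp
      (hgC1.continuous_fderiv one_ne_zero)
  obtain ⟨z0, hz0⟩ := hgc.exists_forall_le hgcoer
  subst hF
  refine ⟨⟨z0, hz0⟩, ?_, ?_, ?_⟩
  · have hclosed : IsClosed {z | ∀ w, g z ≤ g w} := by
      rw [Set.ofPred_forall]
      exact isClosed_iInter fun w => isClosed_le hgc continuous_const
    have hev := hgcoer.eventually (eventually_gt_atTop (g z0))
    obtain ⟨K, hK, hKs⟩ := mem_cocompact.1 hev
    refine hK.of_isClosed_subset hclosed fun z hz => ?_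
    by_contra hzK
    have h1 : g z0 < g z := hKs hzK
    exact absurd (hz z0) (not_le.2 h1)
  · have := hgconv.convex_le (g z0)
    convert this using 1
    ext z
    simp only [Set.mem_ofPred_eq, Set.mem_univ, true_and]
    exact ⟨fun h => h z0, fun h w => h.trans (hz0 w)⟩
  · obtain ⟨r0, hr0⟩ : ∃ r0 : ℝ → EuclideanSpace ℝ (Fin d),
        r0 = fun t => gradient g (x t) - f t (x t) := ⟨_, rfl⟩
    have hr0c : ContinuousOn r0 (Set.Ici 0) := by
      rw [hr0]
      refine (hgrad.comp_continuousOn hxcont).sub ?_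
      exact hfcont.comp (continuousOn_id.prodMk hxcont) (fun t ht => ⟨ht, Set.mem_univ _⟩)
    obtain ⟨r, hr⟩ : ∃ r : ℝ → EuclideanSpace ℝ (Fin d), r = fun t => r0 (max t 0) := ⟨_, rfl⟩
    have hrc : Continuous r := by
      rw [hr]
      exact hr0c.comp_continuous (continuous_id.max continuous_const)
        (fun t => Set.mem_Ici.2 (le_max_right _ _))
    have hreq : ∀ t, 0 ≤ t → r t = gradient g (x t) - f t (x t) := by
      intro t ht
      rw [hr, hr0]
      simp only [max_eq_left ht]
    have hrle : ∀ t, 0 ≤ t → ‖r t‖ ≤ ⨆ z, ‖f t z - gradient g z‖ := by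
      intro t ht
      rw [hreq t ht, norm_sub_rev]
      exact le_ciSup (hbdd t ht) (x t)
    have hrint : IntegrableOn (fun t => ‖r t‖) (Set.Ici 0) := by
      refine Integrable.mono' hint hrc.norm.aestronglyMeasurable ?_
      refine (ae_restrict_iff' measurableSet_Ici).2 (Eventually.of_forall fun t ht => ?_)
      rw [norm_norm]
      exact hrle t ht
    refine aux_core (r := r) (H := fun t => ∫ s in (0 : ℝ)..t, ‖r s‖)
      (B := ∫ s in Set.Ici (0 : ℝ), ‖r s‖) hgconv hgd ?_ ?_ ?_ z0 hz0
    · intro t _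
      exact intervalIntegral.integral_hasDerivAt_right (hrc.norm.intervalIntegrable _ _)
        hrc.norm.stronglyMeasurable.stronglyMeasurableAtFilter hrc.norm.continuousAt
    · intro t ht
      rw [intervalIntegral.integral_of_le ht]
      exact setIntegral_mono_set hrint (Eventually.of_forall fun s => norm_nonneg _)
        (Eventually.of_forall fun s hs => Set.mem_Ici.2 hs.1.le)
    · intro t ht
      have h := hode t ht
      rw [hreq t ht.le]
      convert h using 1
      abel
end

section
/- Let g : ℝ^d → ℝ be convex, continuously differentiable, and coercive (g(x) → +∞ as ‖x‖ → ∞), and let F := argmin g. Let C ≥ 0, λ > 0, let f : [0,∞) × ℝ^d → ℝ^d be continuous with ‖f(t, x) − ∇g(x)‖ ≤ C e^{−λ t} for all t ≥ 0 and x ∈ ℝ^d, and let x : [0,∞) → ℝ^d be differentiable with ẋ(t) = −f(t, x(t)) for all t > 0. Then for every y ∈ F, the function t ↦ ‖x(t) − y‖ + (C/λ) e^{−λ t} is nonincreasing on [0,∞); consequently ‖x(t) − y‖ converges as t → ∞. -/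
open Filter

/-- Lyapunov-type monotonicity for the non-autonomous gradient flow: if `g` is convex,
`C¹` and coercive, `‖f(t,x) − ∇g(x)‖ ≤ C e^{−λt}` and `ẋ(t) = −f(t, x(t))`, then for
every minimizer `y` of `g` the function `t ↦ ‖x(t) − y‖ + (C/λ) e^{−λt}` is nonincreasing
on `[0,∞)`; consequently `‖x(t) − y‖` converges as `t → ∞`. -/
theorem gradient_flow_distance_lyapunov
    (d : ℕ) (g : EuclideanSpace ℝ (Fin d) → ℝ)
    (hgconv : ConvexOn ℝ Set.univ g) (hgC1 : ContDiff ℝ 1 g)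
    (hgcoer : Tendsto g (cocompact (EuclideanSpace ℝ (Fin d))) atTop)
    (F : Set (EuclideanSpace ℝ (Fin d)))
    (hF : F = { z | ∀ w, g z ≤ g w })
    (C lam : ℝ) (hC : 0 ≤ C) (hlam : 0 < lam)
    (f : ℝ → EuclideanSpace ℝ (Fin d) → EuclideanSpace ℝ (Fin d))
    (hfcont : ContinuousOn (fun p : ℝ × EuclideanSpace ℝ (Fin d) => f p.1 p.2)
      (Set.Ici (0 : ℝ) ×ˢ Set.univ))
    (hfapprox : ∀ t : ℝ, 0 ≤ t → ∀ z, ‖f t z - gradient g z‖ ≤ C * Real.exp (-lam * t))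
    (x : ℝ → EuclideanSpace ℝ (Fin d))
    (hxcont : ContinuousOn x (Set.Ici (0 : ℝ)))
    (hode : ∀ t : ℝ, 0 < t → HasDerivAt x (-(f t (x t))) t) :
    ∀ y ∈ F,
      AntitoneOn (fun t => ‖x t - y‖ + C / lam * Real.exp (-lam * t)) (Set.Ici (0 : ℝ)) ∧
      ∃ L : ℝ, Tendsto (fun t => ‖x t - y‖) atTop (nhds L) := by
  intro y hy
  have hymin : ∀ w, g y ≤ g w := by rw [hF] at hy; exact hy
  have hmono : ∀ z, 0 ≤ inner ℝ (gradient g z) (z - y) := by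
    intro z
    have hdiff : DifferentiableAt ℝ g z := (hgC1.differentiable one_ne_zero) z
    have hg := hdiff.hasGradientAt.hasFDerivAt
    have hline : HasDerivAt (fun s : ℝ => AffineMap.lineMap z y s) (y - z) (0 : ℝ) :=
      AffineMap.hasDerivAt_lineMap
    have hg' : HasFDerivAt g (InnerProductSpace.toDual ℝ _ (gradient g z))
        (AffineMap.lineMap z y (0 : ℝ)) := by simpa using hg
    have hh := hg'.comp_hasDerivAt (0 : ℝ) hline
    have hconv : ConvexOn ℝ Set.univ (g ∘ (AffineMap.lineMap z y : ℝ →ᵃ[ℝ] _)) := by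
      simpa using hgconv.comp_affineMap (AffineMap.lineMap z y : ℝ →ᵃ[ℝ] _)
    have h1 := hconv.le_slope_of_hasDerivAt (Set.mem_univ 0) (Set.mem_univ 1) one_pos hh
    rw [InnerProductSpace.toDual_apply_apply] at h1
    simp only [slope_def_field, Function.comp, AffineMap.lineMap_apply_zero,
      AffineMap.lineMap_apply_one, sub_zero, div_one] at h1
    have h2 := hymin z
    have h3 : inner ℝ (gradient g z) (y - z) = - inner ℝ (gradient g z) (z - y) := by
      rw [← inner_neg_right, neg_sub]
    rw [h3] at h1
    linarith
  have hanti : ∀ ε : ℝ, 0 < ε → AntitoneOn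
      (fun t => Real.sqrt (‖x t - y‖ ^ 2 + ε ^ 2) + C / lam * Real.exp (-lam * t))
      (Set.Ici (0 : ℝ)) := by
    intro ε hε
    have hpos : ∀ t, 0 < ‖x t - y‖ ^ 2 + ε ^ 2 := fun t => by positivity
    have hd : ∀ t : ℝ, 0 < t → HasDerivAt
        (fun t => Real.sqrt (‖x t - y‖ ^ 2 + ε ^ 2) + C / lam * Real.exp (-lam * t))
        ((2 * inner ℝ (x t - y) (-(f t (x t)))) / (2 * Real.sqrt (‖x t - y‖ ^ 2 + ε ^ 2))
          + C / lam * (Real.exp (-lam * t) * (-lam * 1))) t := by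
      intro t ht
      have h1 := (((hode t ht).sub_const y).norm_sq.add_const (ε ^ 2)).sqrt (hpos t).ne'
      exact h1.add ((((hasDerivAt_id t).const_mul (-lam)).exp).const_mul (C / lam))
    refine antitoneOn_of_deriv_nonpos (convex_Ici 0) ?_ ?_ ?_
    · have : Continuous fun t : ℝ => C / lam * Real.exp (-lam * t) := by fun_prop
      exact ((((hxcont.sub continuousOn_const).norm.pow 2).add continuousOn_const).sqrt).add
        this.continuousOn
    · intro t ht
      rw [interior_Ici] at ht
      exact (hd t ht).differentiableAt.differentiableWithinAt
    · intro t ht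
      rw [interior_Ici] at ht
      have ht0 : 0 < t := ht
      rw [(hd t ht).deriv]
      set S := Real.sqrt (‖x t - y‖ ^ 2 + ε ^ 2) with hS
      set e := Real.exp (-lam * t) with he
      have hSpos : 0 < S := Real.sqrt_pos.2 (hpos t)
      have hSn : ‖x t - y‖ ≤ S := Real.le_sqrt_of_sq_le (by nlinarith)
      have he0 : 0 ≤ C * e := mul_nonneg hC (Real.exp_pos _).le
      have hin : inner ℝ (x t - y) (-(f t (x t))) ≤ (C * e) * S := by
        have e1 : inner ℝ (x t - y) (-(f t (x t))) =
            - inner ℝ (x t - y) (f t (x t) - gradient g (x t))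
              - inner ℝ (gradient g (x t)) (x t - y) := by
          rw [inner_neg_right, inner_sub_right, real_inner_comm (x t - y) (gradient g (x t))]
          ring
        have e2 := neg_le_of_abs_le
          (abs_real_inner_le_norm (x t - y) (f t (x t) - gradient g (x t)))
        have e3 : ‖x t - y‖ * ‖f t (x t) - gradient g (x t)‖ ≤ S * (C * e) :=
          mul_le_mul hSn (hfapprox t ht0.le (x t)) (norm_nonneg _) hSpos.le
        have e4 := hmono (x t)
        rw [e1]
        linarith
      have hq : (2 * inner ℝ (x t - y) (-(f t (x t)))) / (2 * S) ≤ C * e := by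
        rw [div_le_iff₀ (by positivity)]
        linarith
      have hr : C / lam * (e * (-lam * 1)) = -(C * e) := by
        field_simp
      linarith
  have hA : AntitoneOn (fun t => ‖x t - y‖ + C / lam * Real.exp (-lam * t))
      (Set.Ici (0 : ℝ)) := by
    intro s hs t ht hst
    refine le_of_forall_pos_le_add fun ε hε => ?_
    have h1 := hanti ε hε hs ht hst
    have h2 : ‖x t - y‖ ≤ Real.sqrt (‖x t - y‖ ^ 2 + ε ^ 2) :=
      Real.le_sqrt_of_sq_le (by nlinarith)
    have h3 : Real.sqrt (‖x s - y‖ ^ 2 + ε ^ 2) ≤ ‖x s - y‖ + ε := by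
      apply Real.sqrt_le_iff.2
      have := norm_nonneg (x s - y)
      exact ⟨by positivity, by nlinarith⟩
    simp only at h1 ⊢
    linarith
  refine ⟨hA, ?_⟩
  have hA' : Antitone (fun t : ℝ => (fun t => ‖x t - y‖ + C / lam * Real.exp (-lam * t))
      (max t 0)) := fun s t hst =>
    hA (le_max_right s 0) (le_max_right t 0) (max_le_max_right 0 hst)
  have hT := tendsto_atTop_ciInf hA' ⟨0, by
    rintro _ ⟨t, rfl⟩
    have := Real.exp_pos (-lam * max t 0)
    positivity⟩
  have hE : Tendsto (fun t : ℝ => C / lam * Real.exp (-lam * t)) atTop (nhds (C / lam * 0)) :=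
    (Real.tendsto_exp_atBot.comp
      (tendsto_id.const_mul_atTop_of_neg (neg_lt_zero.2 hlam))).const_mul _
  refine ⟨_, (hT.sub hE).congr' ?_⟩
  filter_upwards [eventually_ge_atTop 0] with t ht
  simp [max_eq_left ht]
end

section
/- Let F ⊆ ℝ^d be nonempty and compact, and let x : [0,∞) → ℝ^d be a continuous curve such that dist(x(t), F) → 0 as t → ∞ and such that for every y ∈ F the limit lim_{t→∞} ‖x(t) − y‖ exists. Then x(t) converges as t → ∞ to some point of F. -/
open Filter

/-- Opial-type lemma: let `F ⊆ ℝ^d` be nonempty and compact and let `x` be a continuous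
curve such that `dist(x(t), F) → 0` as `t → ∞` and `‖x(t) − y‖` converges as `t → ∞` for
every `y ∈ F`. Then `x(t)` converges as `t → ∞` to some point of `F`. -/
theorem opial_type_convergence
    (d : ℕ) (F : Set (EuclideanSpace ℝ (Fin d)))
    (hne : F.Nonempty) (hcomp : IsCompact F)
    (x : ℝ → EuclideanSpace ℝ (Fin d))
    (hxcont : ContinuousOn x (Set.Ici (0 : ℝ)))
    (hdist : Tendsto (fun t => Metric.infDist (x t) F) atTop (nhds 0))
    (hlim : ∀ y ∈ F, ∃ L : ℝ, Tendsto (fun t => ‖x t - y‖) atTop (nhds L)) :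
    ∃ y ∈ F, Tendsto x atTop (nhds y) := by
  choose p hpF hp using fun t : ℝ => hcomp.exists_infDist_eq_dist hne (x t)
  obtain ⟨y, hy, φ, hφ, hφy⟩ := hcomp.tendsto_subseq (fun n : ℕ => hpF (n : ℝ))
  refine ⟨y, hy, ?_⟩
  obtain ⟨L, hL⟩ := hlim y hy
  have hs : Tendsto (fun n : ℕ => ((φ n : ℕ) : ℝ)) atTop atTop :=
    tendsto_natCast_atTop_atTop.comp hφ.tendsto_atTop
  have h1 : Tendsto (fun n : ℕ => ‖x (φ n : ℝ) - y‖) atTop (nhds L) := hL.comp hs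
  have h2 : Tendsto (fun n : ℕ => Metric.infDist (x (φ n : ℝ)) F + dist (p (φ n : ℝ)) y)
      atTop (nhds 0) := by
    have := (hdist.comp hs).add (tendsto_iff_dist_tendsto_zero.1 hφy)
    simpa [Function.comp_def] using this
  have h3 : Tendsto (fun n : ℕ => ‖x (φ n : ℝ) - y‖) atTop (nhds 0) := by
    refine squeeze_zero (fun n => norm_nonneg _) (fun n => ?_) h2
    rw [hp, ← dist_eq_norm]
    exact dist_triangle _ _ _
  have hL0 : L = 0 := tendsto_nhds_unique h1 h3
  rw [hL0] at hL
  exact tendsto_iff_norm_sub_tendsto_zero.2 hL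
end

section
/- Let g : ℝ^d → ℝ be convex, continuously differentiable, and coercive (g(x) → +∞ as ‖x‖ → ∞), and let F := argmin g, which is then nonempty and compact. Let C ≥ 0, λ > 0, let f : [0,∞) × ℝ^d → ℝ^d be continuous with ‖f(t, x) − ∇g(x)‖ ≤ C e^{−λ t} for all t ≥ 0 and x ∈ ℝ^d, and let x : [0,∞) → ℝ^d be differentiable with ẋ(t) = −f(t, x(t)) for all t > 0. Then dist(x(t), F) → 0 as t → ∞. -/
open Filter

lemma aux_convex {d : ℕ} {g : EuclideanSpace ℝ (Fin d) → ℝ}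
    (hgconv : ConvexOn ℝ Set.univ g) (hgd : Differentiable ℝ g)
    (z p : EuclideanSpace ℝ (Fin d)) :
    g z + inner ℝ (gradient g z) (p - z) ≤ g p := by
  have h1 : ConvexOn ℝ Set.univ (fun s : ℝ => g (AffineMap.lineMap z p s)) := by
    exact hgconv.comp_affineMap (AffineMap.lineMap z p : ℝ →ᵃ[ℝ] _)
  have h2 : HasDerivAt (fun s : ℝ => g (AffineMap.lineMap z p s))
      (inner ℝ (gradient g z) (p - z)) 0 := by
    have hg := ((hgd z).hasGradientAt).hasFDerivAt
    have hl : HasDerivAt (fun s : ℝ => (AffineMap.lineMap z p s : EuclideanSpace ℝ (Fin d)))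
      (p - z) 0 := AffineMap.hasDerivAt_lineMap
    have hz : (AffineMap.lineMap z p (0 : ℝ) : EuclideanSpace ℝ (Fin d)) = z := by simp
    rw [← hz] at hg
    have h := hg.comp_hasDerivAt (0 : ℝ) hl
    rw [hz] at h
    exact h
  have h3 := h1.le_slope_of_hasDerivAt (Set.mem_univ 0) (Set.mem_univ 1) one_pos h2
  rw [slope_def_field, AffineMap.lineMap_apply_one, AffineMap.lineMap_apply_zero, sub_zero,
    div_one] at h3
  linarith

lemma aux_static {d : ℕ} {g : EuclideanSpace ℝ (Fin d) → ℝ} (hgc : Continuous g)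
    (hgcoer : Tendsto g (cocompact (EuclideanSpace ℝ (Fin d))) atTop)
    (F : Set (EuclideanSpace ℝ (Fin d)))
    (hF : F = { z | ∀ w, g z ≤ g w }) :
    F.Nonempty ∧ IsCompact F ∧ ∀ p ∈ F, ∀ ε > 0, ∃ δ > 0, ∀ z, g z - g p < δ →
      Metric.infDist z F < ε := by
  have hne : F.Nonempty := by
    obtain ⟨p, hp⟩ := hgc.exists_forall_le hgcoer
    exact ⟨p, by rw [hF]; exact hp⟩
  refine ⟨hne, ?_, ?_⟩
  · obtain ⟨p, hp⟩ := hne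
    have h := hgcoer.eventually (eventually_gt_atTop (g p))
    obtain ⟨K, hK, hKs⟩ := mem_cocompact.1 h
    have hcl : IsClosed F := by
      rw [hF, Set.setOf_forall]
      exact isClosed_iInter fun w => isClosed_le hgc continuous_const
    refine hK.of_isClosed_subset hcl ?_
    intro z hz
    by_contra hzK
    have h1 : g p < g z := hKs hzK
    rw [hF] at hz
    exact absurd (hz p) (not_le.2 h1)
  · intro p hp ε hε
    set S := {z | ε ≤ Metric.infDist z F} with hS
    have hScl : IsClosed S := isClosed_le continuous_const (Metric.continuous_infDist_pt F)
    rcases S.eq_empty_or_nonempty with h0 | ⟨s, hs⟩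
    · refine ⟨1, one_pos, fun z _ => ?_⟩
      by_contra hz
      have : z ∈ S := not_lt.1 hz
      simp [h0] at this
    · obtain ⟨m, hmS, hm⟩ := hgc.continuousOn.exists_isMinOn' hScl hs
        ((hgcoer.eventually (eventually_ge_atTop (g s))).filter_mono inf_le_left)
      have hlt : g p < g m := by
        by_contra hle
        have hmF : m ∈ F := by
          rw [hF] at hp ⊢
          intro w
          exact (not_lt.1 hle).trans (hp w)
        have h1 : ε ≤ Metric.infDist m F := hmS
        rw [Metric.infDist_zero_of_mem hmF] at h1
        linarith
      refine ⟨g m - g p, by linarith, fun z hz => ?_⟩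
      by_contra hzS
      have : g m ≤ g z := hm (show z ∈ S from not_lt.1 hzS)
      linarith

lemma aux_flow {d : ℕ} {g : EuclideanSpace ℝ (Fin d) → ℝ}
    (hgconv : ConvexOn ℝ Set.univ g) (hgd : Differentiable ℝ g)
    (p : EuclideanSpace ℝ (Fin d)) (hp : ∀ w, g p ≤ g w)
    (C lam : ℝ) (hC : 0 ≤ C) (hlam : 0 < lam)
    (f : ℝ → EuclideanSpace ℝ (Fin d) → EuclideanSpace ℝ (Fin d))
    (hfapprox : ∀ t : ℝ, 0 ≤ t → ∀ z, ‖f t z - gradient g z‖ ≤ C * Real.exp (-lam * t))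
    (x : ℝ → EuclideanSpace ℝ (Fin d))
    (hode : ∀ t : ℝ, 0 < t → HasDerivAt x (-(f t (x t))) t) :
    ∃ B : ℝ, ∀ t, 1 ≤ t → (t - 1) * (g (x t) - g p) ≤ B := by
  set K := C ^ 2 / (8 * lam) with hK
  set a := K / (2 * lam) with ha
  have hK0 : 0 ≤ K := by positivity
  have ha0 : 0 ≤ a := by positivity
  let e : ℝ → ℝ := fun t => Real.exp (-lam * t)
  let E : ℝ → ℝ := fun t => Real.exp (C / lam * e t)
  let D : ℝ → ℝ := fun t => (1/2) * ‖x t - p‖ ^ 2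
  let V : ℝ → ℝ := fun t => g (x t) - g p
  let P : ℝ → ℝ := fun t => (D t + 1/2) * E t + a * (e t) ^ 2 + (t - 1) * (V t + K * (e t) ^ 2)
  have hP : ∀ t, 1 ≤ t → ∃ P', HasDerivAt P P' t ∧ P' ≤ 0 := by
    intro t ht
    have hx := hode t (by linarith)
    have he : HasDerivAt e (-lam * e t) t := by
      have := ((hasDerivAt_id t).const_mul (-lam)).exp
      simpa [e, mul_comm] using this
    have hE : HasDerivAt E (E t * (C / lam * (-lam * e t))) t := (he.const_mul (C / lam)).exp
    have hD : HasDerivAt D ((1/2) * (2 * inner ℝ (x t - p) (-(f t (x t))))) t :=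
      ((hx.sub_const p).norm_sq).const_mul _
    have hV : HasDerivAt V (inner ℝ (gradient g (x t)) (-(f t (x t)))) t := by
      have := ((hgd (x t)).hasGradientAt.hasFDerivAt.comp_hasDerivAt t hx).sub_const (g p)
      simpa [V] using this
    have he2 := he.pow 2
    have hPd := (((hD.add_const (1/2)).mul hE).add (he2.const_mul a)).add
      (((hasDerivAt_id t).sub_const 1).mul (hV.add (he2.const_mul K)))
    refine ⟨_, hPd, ?_⟩
    have hepos : 0 < e t := Real.exp_pos _
    have hE1 : 1 ≤ E t := Real.one_le_exp (by positivity)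
    have hV0 : 0 ≤ V t := sub_nonneg.2 (hp _)
    have hcv := aux_convex hgconv hgd (x t) p
    have hap := hfapprox t (by linarith) (x t)
    change _ ≤ C * e t at hap
    set G := gradient g (x t) with hG
    set r := f t (x t) - G with hr
    have hf : f t (x t) = G + r := by rw [hr]; abel
    have i1 : inner ℝ (x t - p) (-(f t (x t))) ≤ -V t + C * e t * (D t + 1/2) := by
      have e1 : inner ℝ (x t - p) (-(f t (x t)))
          = inner ℝ G (p - x t) - inner ℝ (x t - p) r := by
        rw [hf, inner_neg_right, inner_add_right, ← neg_sub (x t) p, inner_neg_right,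
          real_inner_comm G]
        ring
      have e2 : -inner ℝ (x t - p) r ≤ ‖x t - p‖ * ‖r‖ :=
        (neg_le_abs _).trans (abs_real_inner_le_norm _ _)
      have e3 : ‖x t - p‖ * ‖r‖ ≤ (D t + 1/2) * (C * e t) := by
        apply mul_le_mul _ hap (norm_nonneg _) (by positivity)
        simp only [D]
        nlinarith [sq_nonneg (‖x t - p‖ - 1)]
      rw [e1]
      simp only [V]
      linarith
    have i2 : inner ℝ G (-(f t (x t))) ≤ (C * e t) ^ 2 / 4 := by
      rw [hf, inner_neg_right, inner_add_right, real_inner_self_eq_norm_sq]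
      have e2 : -inner ℝ G r ≤ ‖G‖ * ‖r‖ :=
        (neg_le_abs _).trans (abs_real_inner_le_norm _ _)
      have e3 : ‖G‖ * ‖r‖ ≤ ‖G‖ * (C * e t) := by gcongr
      nlinarith [sq_nonneg (‖G‖ - C * e t / 2)]
    have c1 : C / lam * (-lam * e t) = -(C * e t) := by field_simp
    have c2 : a * (2 * e t * (-lam * e t)) = - (K * e t ^ 2) := by
      rw [ha]; field_simp
    have c3 : K * (2 * e t * (-lam * e t)) = - ((C * e t) ^ 2 / 4) := by
      rw [hK]; field_simp; ring
    have j1 : inner ℝ (x t - p) (-(f t (x t))) * E t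
        ≤ (-V t + C * e t * (D t + 1/2)) * E t := by gcongr
    have j2 : (t - 1) * (inner ℝ G (-(f t (x t))) - (C * e t) ^ 2 / 4) ≤ 0 :=
      mul_nonpos_of_nonneg_of_nonpos (by linarith) (by linarith)
    have j3 : V t ≤ V t * E t := le_mul_of_one_le_right hV0 hE1
    simp only [id, Nat.cast_ofNat, Nat.add_one_sub_one, pow_one, Pi.add_apply, Pi.mul_apply, Pi.pow_apply]
    rw [c1, c2, c3]
    linarith
  have hanti : AntitoneOn P (Set.Ici 1) := by
    apply antitoneOn_of_deriv_nonpos (convex_Ici 1)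
    · intro t ht
      obtain ⟨P', h, _⟩ := hP t ht
      exact h.continuousAt.continuousWithinAt
    · intro t ht
      rw [interior_Ici] at ht
      obtain ⟨P', h, _⟩ := hP t (le_of_lt ht)
      exact h.differentiableAt.differentiableWithinAt
    · intro t ht
      rw [interior_Ici] at ht
      obtain ⟨P', h, h'⟩ := hP t (le_of_lt ht)
      rw [h.deriv]; exact h'
  refine ⟨P 1, fun t ht => ?_⟩
  have h := hanti (Set.mem_Ici.2 le_rfl) (Set.mem_Ici.2 ht) ht
  refine le_trans ?_ h
  have h1 : 0 ≤ (D t + 1/2) * E t := by positivity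
  have h2 : 0 ≤ a * (e t) ^ 2 := by positivity
  have h3 : 0 ≤ (t - 1) * (K * (e t) ^ 2) := mul_nonneg (by linarith) (by positivity)
  simp only [P]
  rw [mul_add]
  simp only [V]
  linarith

/-- If `g` is convex, `C¹` and coercive on `ℝ^d` with `F := argmin g` (nonempty and
compact), `‖f(t,x) − ∇g(x)‖ ≤ C e^{−λt}` and `ẋ(t) = −f(t, x(t))`, then
`dist(x(t), F) → 0` as `t → ∞`. -/
theorem gradient_flow_dist_to_argmin_tendsto_zero
    (d : ℕ) (g : EuclideanSpace ℝ (Fin d) → ℝ)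
    (hgconv : ConvexOn ℝ Set.univ g) (hgC1 : ContDiff ℝ 1 g)
    (hgcoer : Tendsto g (cocompact (EuclideanSpace ℝ (Fin d))) atTop)
    (F : Set (EuclideanSpace ℝ (Fin d)))
    (hF : F = { z | ∀ w, g z ≤ g w })
    (C lam : ℝ) (hC : 0 ≤ C) (hlam : 0 < lam)
    (f : ℝ → EuclideanSpace ℝ (Fin d) → EuclideanSpace ℝ (Fin d))
    (hfcont : ContinuousOn (fun p : ℝ × EuclideanSpace ℝ (Fin d) => f p.1 p.2)
      (Set.Ici (0 : ℝ) ×ˢ Set.univ))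
    (hfapprox : ∀ t : ℝ, 0 ≤ t → ∀ z, ‖f t z - gradient g z‖ ≤ C * Real.exp (-lam * t))
    (x : ℝ → EuclideanSpace ℝ (Fin d))
    (hxcont : ContinuousOn x (Set.Ici (0 : ℝ)))
    (hode : ∀ t : ℝ, 0 < t → HasDerivAt x (-(f t (x t))) t) :
    F.Nonempty ∧ IsCompact F ∧
      Tendsto (fun t => Metric.infDist (x t) F) atTop (nhds 0) := by
  have hgd : Differentiable ℝ g := hgC1.differentiable one_ne_zero
  obtain ⟨hne, hcomp, hδ⟩ := aux_static hgC1.continuous hgcoer F hF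
  refine ⟨hne, hcomp, ?_⟩
  obtain ⟨p, hp⟩ := hne
  have hp' : ∀ w, g p ≤ g w := by rw [hF] at hp; exact hp
  obtain ⟨B, hB⟩ := aux_flow hgconv hgd p hp' C lam hC hlam f hfapprox x hode
  rw [Metric.tendsto_atTop]
  intro ε hε
  obtain ⟨δ, hδ0, hδ'⟩ := hδ p hp ε hε
  refine ⟨|B| / δ + 2, fun t ht => ?_⟩
  have h0 : 0 ≤ |B| / δ := by positivity
  rw [Real.dist_eq, sub_zero, abs_of_nonneg Metric.infDist_nonneg]
  apply hδ'
  by_contra hcon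
  have h1 := hB t (by linarith)
  have h2 : (|B| / δ + 1) * δ ≤ (t - 1) * (g (x t) - g p) :=
    mul_le_mul (by linarith) (not_lt.1 hcon) hδ0.le (by linarith)
  have h3 : (|B| / δ + 1) * δ = |B| + δ := by field_simp
  linarith [le_abs_self B]
end
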